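/- arXiv:math/0412530 — 3 statements merged into one kernel-verified Lean document; each statement's English description precedes it below -/
import Mathlib

section
/- Let p be a prime, n ≥ 1, and let G = γ₁ × γ₂ × ⋯ × γ_{3n} be a torus with 3n dimensions such that |G| = p^r for some positive integer r (equivalently, the number of vertices of every cycle γ_i is a power of p). Then mrl(G) ≥ n + 1. -/
/-!
A torus is the Cartesian (box) product of cycle graphs `γ₁ × ⋯ × γ_k` where
`γ_i` is a cycle on `sz i ≥ 3` vertices.  We model its vertex set as
`∀ i, ZMod (sz i)`, with two vertices adjacent when they differ in exactly one
coordinate, by `±1` around that cycle.  A Hamiltonian cycle is a cyclic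
enumeration `f : ZMod N → V` (with `N` the number of vertices) which is
bijective and takes consecutive vertices to adjacent vertices.  The run length
of a Hamiltonian cycle is the largest `r ≥ 1` such that any `r` consecutive
edges contain at most one edge in any single dimension, and `mrl` is the
maximum run length over all Hamiltonian cycles.
-/

/-- Vertices of the torus with dimension sizes `sz`. -/
def TorusVtx (k : ℕ) (sz : Fin k → ℕ) : Type := ∀ i : Fin k, ZMod (sz i)

/-- The number of vertices of the torus with dimension sizes `sz`. -/
def torusCard (k : ℕ) (sz : Fin k → ℕ) : ℕ := ∏ i : Fin k, sz i

/-- Adjacency in the torus: the two vertices differ in exactly one coordinate,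
and there by one step around the corresponding cycle. -/
def TorusAdj {k : ℕ} {sz : Fin k → ℕ} (u v : TorusVtx k sz) : Prop :=
  ∃ i : Fin k, (v i = u i + 1 ∨ u i = v i + 1) ∧ ∀ j : Fin k, j ≠ i → u j = v j

/-- A Hamiltonian cycle of the torus, as a cyclic enumeration of all of its
vertices in which consecutive vertices are adjacent. -/
def IsHamCycle {k : ℕ} {sz : Fin k → ℕ}
    (f : ZMod (torusCard k sz) → TorusVtx k sz) : Prop :=
  Function.Bijective f ∧ ∀ t, TorusAdj (f t) (f (t + 1))

/-- The edge of the cycle `f` at position `s` (joining `f s` to `f (s+1)`)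
is in dimension `i`, i.e. its endpoints differ in coordinate `i`. -/
def EdgeInDim {k : ℕ} {sz : Fin k → ℕ}
    (f : ZMod (torusCard k sz) → TorusVtx k sz) (i : Fin k)
    (s : ZMod (torusCard k sz)) : Prop :=
  f s i ≠ f (s + 1) i

/-- Any `r` consecutive edges of the cycle `f` (read cyclically) contain at
most one edge in any single dimension. -/
def WindowOk {k : ℕ} {sz : Fin k → ℕ}
    (f : ZMod (torusCard k sz) → TorusVtx k sz) (r : ℕ) : Prop :=
  ∀ (t : ZMod (torusCard k sz)) (i : Fin k) (a b : ℕ), a < r → b < r → a ≠ b →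
    ¬(EdgeInDim f i (t + (a : ZMod (torusCard k sz))) ∧
      EdgeInDim f i (t + (b : ZMod (torusCard k sz))))

/-- The run length of a Hamiltonian cycle: the largest `r ≥ 1` such that any
`r` consecutive edges contain at most one edge in any single dimension. -/
noncomputable def runLength {k : ℕ} {sz : Fin k → ℕ}
    (f : ZMod (torusCard k sz) → TorusVtx k sz) : ℕ :=
  sSup {r : ℕ | 1 ≤ r ∧ WindowOk f r}

/-- The maximum run length of the torus: the maximum of `runLength` over all
of its Hamiltonian cycles. -/
noncomputable def mrl (k : ℕ) (sz : Fin k → ℕ) : ℕ :=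
  sSup {m : ℕ | ∃ f, IsHamCycle (k := k) (sz := sz) f ∧ m = runLength f}

/-- A closed walk of period `∏ i, sz i` through all vertices of the torus, lifted to integer
coordinates, in which edges less than `L` steps apart have different dimensions; `e t` is the
dimension of the `t`-th edge. -/
structure IsLiftedCycle {ι : Type} [Fintype ι] (sz : ι → ℕ) (L : ℕ)
    (f : ℕ → ι → ℤ) (e : ℕ → ι) : Prop where
  step : ∀ t, (f (t + 1) (e t) = f t (e t) + 1 ∨ f t (e t) = f (t + 1) (e t) + 1) ∧
    ∀ j, j ≠ e t → f t j = f (t + 1) j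
  period : ∀ t i, f (t + ∏ i, sz i) i ≡ f t i [ZMOD sz i]
  surj : ∀ v : ι → ℤ, ∃ t, ∀ i, f t i ≡ v i [ZMOD sz i]
  gap : ∀ t j, 0 < j → j < L → e (t + j) ≠ e t

/-- The torus with dimensions `sz` has a Hamiltonian cycle of run length at least `L`. -/
def HasLongCycle {ι : Type} [Fintype ι] (sz : ι → ℕ) (L : ℕ) : Prop :=
  ∃ f e, IsLiftedCycle sz L f e

theorem HasLongCycle.of_comp_equiv {ι κ : Type} [Fintype ι] [Fintype κ] (g : κ ≃ ι)
    {sz : ι → ℕ} {L : ℕ} (h : HasLongCycle (sz ∘ g) L) : HasLongCycle sz L := by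
  obtain ⟨f, e, h⟩ := h
  have hprod : ∏ i, (sz ∘ g) i = ∏ i, sz i := g.prod_comp sz
  refine ⟨fun t i => f t (g.symm i), fun t => g (e t), ⟨fun t => ?_, fun t i => ?_,
    fun v => ?_, fun t j h0 hj => ?_⟩⟩
  · simpa using ⟨(h.step t).1, fun j hj => (h.step t).2 (g.symm j)
      (fun h' => hj (by rw [← h']; simp))⟩
  · have := h.period t (g.symm i)
    rw [hprod] at this
    simpa using this
  · obtain ⟨t, ht⟩ := h.surj (v ∘ g)
    exact ⟨t, fun i => by simpa using ht (g.symm i)⟩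
  · simpa using h.gap t j h0 hj

theorem IsLiftedCycle.period_mul {ι : Type} [Fintype ι] {sz : ι → ℕ} {L : ℕ}
    {f : ℕ → ι → ℤ} {e : ℕ → ι} (h : IsLiftedCycle sz L f e) (t k : ℕ) (i : ι) :
    f (t + k * ∏ i, sz i) i ≡ f t i [ZMOD sz i] := by
  induction k with
  | zero => simp [Int.ModEq]
  | succ k ih =>
    rw [Nat.succ_mul, ← Nat.add_assoc]
    exact (h.period _ i).trans ih

theorem IsLiftedCycle.congr_of_modEq {ι : Type} [Fintype ι] {sz : ι → ℕ} {L : ℕ}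
    {f : ℕ → ι → ℤ} {e : ℕ → ι} (h : IsLiftedCycle sz L f e) {t u : ℕ}
    (htu : t ≡ u [MOD ∏ i, sz i]) (i : ι) : f t i ≡ f u i [ZMOD sz i] := by
  have key : ∀ s, f s i ≡ f (s % ∏ i, sz i) i [ZMOD sz i] := fun s => by
    conv_lhs => rw [← Nat.mod_add_div' s (∏ i, sz i)]
    exact h.period_mul _ _ i
  have := (key t).trans ((congrArg (fun s => f s i) htu : _ = _) ▸ (key u).symm)
  exact this

/-- A congruence `k * d ≡ v` modulo `c` has a natural solution if `d` is a unit modulo `c`. -/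
theorem exists_nat_mul_modEq {c : ℕ} (hc : 0 < c) {d : ℤ} (hd : IsCoprime d c) (v : ℤ) :
    ∃ k : ℕ, (k : ℤ) * d ≡ v [ZMOD c] := by
  obtain ⟨a, b, hab⟩ := hd
  have hc' : (0 : ℤ) < c := by exact_mod_cast hc
  refine ⟨((v * a) % c).toNat, ?_⟩
  rw [Int.toNat_of_nonneg (Int.emod_nonneg _ hc'.ne')]
  have h1 : (v * a) % c * d ≡ v * a * d [ZMOD c] := (Int.mod_modEq _ _).mul_right _
  refine h1.trans (Int.modEq_iff_dvd.2 ⟨v * b, ?_⟩)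
  linear_combination -v * hab

theorem HasLongCycle.sum {ι κ : Type} [Fintype ι] [Fintype κ] {sz : ι → ℕ} {sz' : κ → ℕ}
    {L₁ L₂ s t : ℕ} (h₁ : HasLongCycle sz L₁) (h₂ : HasLongCycle sz' L₂)
    (hst : s + t = ∏ i, sz i) (hdvd : ∏ i, sz i ∣ ∏ i, sz' i) (hpos : 0 < ∏ i, sz' i)
    (ht : Nat.Coprime t (∏ i, sz' i))
    (hlow : (L₁ - 1) * (s + t) ≤ (L₁ + L₂ - 1) * s) (hup : (L₁ + L₂ - 1) * s ≤ L₁ * (s + t))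
    (hL₁ : 1 ≤ L₁) (hL₂ : 1 ≤ L₂) :
    HasLongCycle (Sum.elim sz sz') (L₁ + L₂ - 1) := by
  obtain ⟨f, e, hf⟩ := h₁
  obtain ⟨g, e', hg⟩ := h₂
  set M := ∏ i, sz i with hM
  set N := ∏ i, sz' i with hN
  have hMpos : 0 < M := Nat.pos_of_dvd_of_pos hdvd hpos
  set A : ℕ → ℕ := fun n => n * s / M with hA
  have hAle : ∀ n, A n ≤ n := fun n => by
    refine Nat.div_le_of_le_mul ?_
    rw [Nat.mul_comm]
    exact Nat.mul_le_mul_right _ (by omega)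
  have hAmono : Monotone A := fun a b hab =>
    Nat.div_le_div_right (Nat.mul_le_mul_right _ hab)
  set B : ℕ → ℕ := fun n => n - A n with hB
  have hAB : ∀ n, A n + B n = n := fun n => by have := hAle n; simp only [hB]; omega
  have hAshift : ∀ n k, A (n + M * k) = A n + s * k := fun n k => by
    simp only [hA]
    rw [show (n + M * k) * s = n * s + M * (s * k) by ring, Nat.add_mul_div_left _ _ hMpos]
  have hBshift : ∀ n k, B (n + M * k) = B n + t * k := fun n k => by
    have h1 := hAB n
    have h2 := hAB (n + M * k)
    rw [hAshift] at h2
    have : M * k = s * k + t * k := by rw [← hst]; ring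
    omega
  have hAsucc : ∀ n, A (n + 1) = A n ∨ A (n + 1) = A n + 1 := fun n => by
    have h1 : A n ≤ A (n + 1) := hAmono (Nat.le_succ n)
    have h2 : A (n + 1) ≤ A n + 1 := by
      have : (n + 1) * s ≤ n * s + M * 1 := by nlinarith
      calc A (n + 1) ≤ (n * s + M * 1) / M := Nat.div_le_div_right this
        _ = A n + 1 := Nat.add_mul_div_left _ _ hMpos
    omega
  have hAwin : ∀ n j, j ≤ L₁ + L₂ - 1 → A (n + j) ≤ A n + L₁ := fun n j hj => by
    refine (hAmono (Nat.add_le_add_left hj n)).trans ?_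
    have : (n + (L₁ + L₂ - 1)) * s ≤ n * s + M * L₁ := by rw [← hst]; nlinarith
    calc _ ≤ (n * s + M * L₁) / M := Nat.div_le_div_right this
      _ = A n + L₁ := Nat.add_mul_div_left _ _ hMpos
  have hBmono : Monotone B := monotone_nat_of_le_succ fun n => by
    have h1 := hAB n
    have h2 := hAB (n + 1)
    rcases hAsucc n with h | h <;> omega
  have hBwin : ∀ n j, j ≤ L₁ + L₂ - 1 → B (n + j) ≤ B n + L₂ := fun n j hj => by
    refine (hBmono (Nat.add_le_add_left hj n)).trans ?_
    have : A n + (L₁ - 1) ≤ A (n + (L₁ + L₂ - 1)) := by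
      have : n * s + M * (L₁ - 1) ≤ (n + (L₁ + L₂ - 1)) * s := by rw [← hst]; nlinarith
      calc _ = (n * s + M * (L₁ - 1)) / M := (Nat.add_mul_div_left _ _ hMpos).symm
        _ ≤ _ := Nat.div_le_div_right this
    have h1 := hAB n
    have h2 := hAB (n + (L₁ + L₂ - 1))
    omega
  have hprod : ∏ i, Sum.elim sz sz' i = M * N := by simp [hM, hN]
  refine ⟨fun n => Sum.elim (f (A n)) (g (B n)),
    fun n => if A (n + 1) = A n then Sum.inr (e' (B n)) else Sum.inl (e (A n)),
    ⟨fun n => ?_, fun n i => ?_, fun v => ?_, fun n j h0 hj => ?_⟩⟩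
  · have h1 := hAB n
    have h2 := hAB (n + 1)
    rcases hAsucc n with h | h
    · have hB1 : B (n + 1) = B n + 1 := by omega
      rw [if_pos h, h, hB1]
      refine ⟨(hg.step (B n)).1, ?_⟩
      rintro (j | j) hj
      · rfl
      · exact (hg.step (B n)).2 j (fun h' => hj (by rw [h']))
    · have hB1 : B (n + 1) = B n := by omega
      rw [if_neg (by omega), h, hB1]
      refine ⟨(hf.step (A n)).1, ?_⟩
      rintro (j | j) hj
      · exact (hf.step (A n)).2 j (fun h' => hj (by rw [h']))
      · rfl
  · rw [hprod, hAshift, hBshift]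
    rcases i with i | i
    · refine hf.congr_of_modEq ?_ i
      obtain ⟨r, hr⟩ := hdvd
      rw [hr, ← hM]
      simp [Nat.ModEq, Nat.mul_left_comm s]
    · refine hg.congr_of_modEq ?_ i
      simp [Nat.ModEq, ← hN]
  · obtain ⟨a, ha⟩ := hf.surj (v ∘ Sum.inl)
    obtain ⟨b, hb⟩ := hg.surj (v ∘ Sum.inr)
    set r := (a + b) % M
    obtain ⟨k, hk⟩ := exists_nat_mul_modEq hpos (Nat.isCoprime_iff_coprime.2 ht) (b - B r)
    have hBk : B (r + M * k) ≡ b [MOD N] := by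
      rw [hBshift, ← Int.natCast_modEq_iff]
      push_cast
      have := hk.add_left (B r : ℤ)
      rw [add_sub_cancel] at this
      rwa [mul_comm (t : ℤ)]
    have hAk : A (r + M * k) ≡ a [MOD M] := by
      have h1 : A (r + M * k) + B (r + M * k) ≡ a + b [MOD M] := by
        rw [hAB]
        simp [Nat.ModEq, r]
      exact Nat.ModEq.add_right_cancel (hBk.of_dvd hdvd) h1
    refine ⟨r + M * k, ?_⟩
    rintro (i | i)
    · exact (hf.congr_of_modEq hAk i).trans (ha i)
    · exact (hg.congr_of_modEq hBk i).trans (hb i)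
  · have h1 := hAB n
    have h2 := hAB (n + 1)
    have h3 := hAB (n + j)
    have h4 := hAB (n + j + 1)
    have hA1 := hAwin n (j + 1) (by omega)
    have hB1 := hBwin n (j + 1) (by omega)
    have hA2 : A (n + 1) ≤ A (n + j) := hAmono (by omega)
    have hB2 : B (n + 1) ≤ B (n + j) := hBmono (by omega)
    rw [← Nat.add_assoc] at hA1 hB1
    split_ifs with p q q
    · have hs := hAsucc n
      have := hg.gap (B n) (B (n + j) - B n) (by omega) (by omega)
      rw [Nat.add_sub_cancel' (by omega)] at this
      simpa using this
    · simp
    · simp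
    · have hs := hAsucc n
      have hs' := hAsucc (n + j)
      have := hf.gap (A n) (A (n + j) - A n) (by omega) (by omega)
      rw [Nat.add_sub_cancel' (by omega)] at this
      simpa using this

/-- The displacement in dimension `i` along a word of steps `(dimension, increment)`. -/
def disp {ι : Type} [DecidableEq ι] (w : List (ι × ℤ)) (i : ι) : ℤ :=
  (w.map fun s => if s.1 = i then s.2 else 0).sum

/-- A word of unit steps, starting in dimension `i` and ending in dimension `k`, whose consecutive
steps have different dimensions. -/
structure AltWord {ι : Type} (w : List (ι × ℤ)) (i k : ι) : Prop where
  chain : w.IsChain fun a b => a.1 ≠ b.1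
  head : w.head?.map Prod.fst = some i
  last : w.getLast?.map Prod.fst = some k
  unit : ∀ s ∈ w, s.2 = 1 ∨ s.2 = -1

theorem AltWord.append {ι : Type} {w w' : List (ι × ℤ)} {i k i' k' : ι} (h : AltWord w i k)
    (h' : AltWord w' i' k') (hk : k ≠ i') : AltWord (w ++ w') i k' := by
  obtain ⟨h1, h2, h3, h4⟩ := h
  obtain ⟨h1', h2', h3', h4'⟩ := h'
  refine ⟨h1.append h1' fun x hx y hy => ?_, ?_, ?_, fun s hs => ?_⟩
  · rw [Option.mem_def] at hx hy
    rw [hx] at h3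
    rw [hy] at h2'
    simp only [Option.map_some, Option.some.injEq] at h3 h2'
    rwa [h3, h2']
  · rcases w with _ | ⟨a, w⟩
    · simp at h2
    · simpa using h2
  · rw [List.getLast?_append]
    rcases h : w'.getLast? with _ | a
    · simp [h] at h3'
    · simpa [h] using h3'
  · rcases List.mem_append.1 hs with hs | hs
    exacts [h4 s hs, h4' s hs]

theorem AltWord.append_replicate {ι : Type} {u w : List (ι × ℤ)} {j i k : ι} (hu : AltWord u j k)
    (hw : AltWord w i k) (hk : k ≠ i) (n : ℕ) :
    AltWord (u ++ (List.replicate n w).flatten) j k := by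
  induction n with
  | zero => simpa using hu
  | succ n ih =>
    rw [List.replicate_succ', List.flatten_concat, ← List.append_assoc]
    exact ih.append hw hk

section disp

variable {ι : Type} [DecidableEq ι]

@[simp] theorem disp_nil (i : ι) : disp ([] : List (ι × ℤ)) i = 0 := rfl

@[simp] theorem disp_cons (s : ι × ℤ) (w : List (ι × ℤ)) (i : ι) :
    disp (s :: w) i = (if s.1 = i then s.2 else 0) + disp w i := by simp [disp]

@[simp] theorem disp_append (w w' : List (ι × ℤ)) (i : ι) :
    disp (w ++ w') i = disp w i + disp w' i := by simp [disp]

@[simp] theorem disp_flatten_replicate (n : ℕ) (w : List (ι × ℤ)) (i : ι) :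
    disp (List.replicate n w).flatten i = n * disp w i := by
  induction n with
  | zero => simp
  | succ n ih => simp [List.replicate_succ, ih]; ring

end disp

theorem hasLongCycle_of_word {ι : Type} [Fintype ι] [DecidableEq ι] {sz : ι → ℕ}
    {w : List (ι × ℤ)} {i k : ι} (hw : AltWord w i k) (hik : k ≠ i) {c : ℕ}
    (hc : w.length * c = ∏ i, sz i) (hD : ∀ i, (c : ℤ) * disp w i ≡ 0 [ZMOD sz i])
    (hcov : ∀ v : ι → ℤ, ∃ n q : ℕ, q < w.length ∧
      ∀ i, (n : ℤ) * disp w i + disp (w.take q) i ≡ v i [ZMOD sz i]) :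
    HasLongCycle sz 2 := by
  have hQ : 0 < w.length := by
    rcases w with _ | ⟨a, w⟩
    · simpa using hw.head
    · simp
  have hsucc : ∀ t, (t % w.length + 1 < w.length ∧ (t + 1) / w.length = t / w.length ∧
      (t + 1) % w.length = t % w.length + 1) ∨ (t % w.length + 1 = w.length ∧
      (t + 1) / w.length = t / w.length + 1 ∧ (t + 1) % w.length = 0) := fun t => by
    have h1 := Nat.mod_lt t hQ
    have h2 := Nat.div_add_mod t w.length
    rcases Nat.lt_or_ge (t % w.length + 1) w.length with h | h
    · refine Or.inl ⟨h, ?_⟩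
      have := (Nat.div_mod_unique (d := t / w.length) (c := t % w.length + 1) hQ).2
        ⟨by rw [Nat.add_comm _ (w.length * _), ← Nat.add_assoc, h2], h⟩
      exact this
    · refine Or.inr ⟨by omega, ?_⟩
      have := (Nat.div_mod_unique (d := t / w.length + 1) (c := 0) (a := t + 1) hQ).2
        ⟨by rw [Nat.mul_add, Nat.mul_one]; omega, hQ⟩
      exact this
  refine ⟨fun t j => ((t / w.length : ℕ) : ℤ) * disp w j + disp (w.take (t % w.length)) j,
    fun t => (w[t % w.length]'(Nat.mod_lt _ hQ)).1, ⟨fun t => ?_, fun t j => ?_, fun v => ?_,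
    fun t j h0 hj => ?_⟩⟩
  · set q := t % w.length with hq
    have hlt : q < w.length := Nat.mod_lt _ hQ
    have key : ∀ j, (((t + 1) / w.length : ℕ) : ℤ) * disp w j +
        disp (w.take ((t + 1) % w.length)) j = ((t / w.length : ℕ) : ℤ) * disp w j +
        disp (w.take q) j + (if w[q].1 = j then w[q].2 else 0) := fun j => by
      have htake : disp (w.take (q + 1)) j =
          disp (w.take q) j + (if w[q].1 = j then w[q].2 else 0) := by
        rw [List.take_succ_eq_append_getElem hlt, disp_append]
        simp
      rcases hsucc t with ⟨-, h1, h2⟩ | ⟨h0, h1, h2⟩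
      · rw [h1, h2, htake]; ring
      · rw [h1, h2]
        rw [h0, List.take_length] at htake
        simp only [List.take_zero, disp_nil]
        push_cast
        linear_combination htake
    refine ⟨?_, fun j hj => ?_⟩
    · rw [key, if_pos rfl]
      rcases hw.unit w[q] (List.getElem_mem _) with h | h <;> rw [h]
      · left; ring
      · right; ring
    · rw [key, if_neg (Ne.symm hj), add_zero]
  · rw [← hc, Nat.add_mul_mod_self_left, Nat.add_mul_div_left _ _ hQ]
    have := (hD j).add_right (((t / w.length : ℕ) : ℤ) * disp w j + disp (w.take (t % w.length)) j)
    rw [Nat.cast_add]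
    rw [zero_add] at this
    refine Eq.trans ?_ this
    congr 1
    ring
  · obtain ⟨n, q, hq, h⟩ := hcov v
    refine ⟨n * w.length + q, fun j => ?_⟩
    have h1 : (n * w.length + q) / w.length = n := by
      rw [Nat.mul_comm, Nat.mul_add_div hQ, Nat.div_eq_of_lt hq, Nat.add_zero]
    have h2 : (n * w.length + q) % w.length = q := by
      rw [Nat.mul_comm, Nat.mul_add_mod, Nat.mod_eq_of_lt hq]
    simp only [h1, h2]
    exact h j
  · obtain rfl : j = 1 := by omega
    rcases hsucc t with ⟨h0, -, h2⟩ | ⟨h0, -, h2⟩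
    · simp only [h2]
      exact (List.isChain_iff_getElem.1 hw.chain _ h0).symm
    · simp only [h2]
      have hlast := hw.last
      have hhead := hw.head
      rw [List.getLast?_eq_getElem?, List.getElem?_eq_getElem (by omega)] at hlast
      rw [List.head?_eq_getElem?, List.getElem?_eq_getElem hQ] at hhead
      simp only [Option.map_some, Option.some.injEq] at hlast hhead
      have h3 : t % w.length = w.length - 1 := by omega
      simp only [h3, hhead, hlast]
      exact hik.symm

/-- The projection of the displacement of a word in three dimensions that adds up the last two. -/
def shear (w : List (Fin 3 × ℤ)) : ℤ × ℤ := (disp w 1 + disp w 2, disp w 0)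

@[simp] theorem shear_append (w w' : List (Fin 3 × ℤ)) :
    shear (w ++ w') = shear w + shear w' := by
  ext <;> simp [shear]
  ring

@[simp] theorem shear_flatten_replicate (n : ℕ) (w : List (Fin 3 × ℤ)) :
    shear (List.replicate n w).flatten = n • shear w := by
  ext <;> simp [shear]
  ring

/-- The walk along `w` leaves a point projecting to `P`. -/
def Visits (w : List (Fin 3 × ℤ)) (P : ℤ × ℤ) : Prop :=
  ∃ q < w.length, shear (w.take q) = P

theorem Visits.append_right {w : List (Fin 3 × ℤ)} {P : ℤ × ℤ} (h : Visits w P)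
    (w' : List (Fin 3 × ℤ)) : Visits (w ++ w') P := by
  obtain ⟨q, hq, h⟩ := h
  exact ⟨q, by simp; omega, by rw [List.take_append_of_le_length hq.le, h]⟩

theorem Visits.append_left {w : List (Fin 3 × ℤ)} {P : ℤ × ℤ} (h : Visits w P)
    (w' : List (Fin 3 × ℤ)) : Visits (w' ++ w) (shear w' + P) := by
  obtain ⟨q, hq, h⟩ := h
  exact ⟨w'.length + q, by simp; omega, by rw [List.take_length_add_append, shear_append, h]⟩

theorem Visits.flatten_replicate {w : List (Fin 3 × ℤ)} {P : ℤ × ℤ} (h : Visits w P)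
    {i n : ℕ} (hi : i < n) : Visits (List.replicate n w).flatten (i • shear w + P) := by
  obtain ⟨m, rfl⟩ := Nat.exists_eq_add_of_lt hi
  rw [Nat.add_assoc, List.replicate_add, List.flatten_append, List.replicate_succ,
    List.flatten_cons, ← shear_flatten_replicate]
  exact (h.append_right _).append_left _

/-- A word moving in the direction `ε` in the last two dimensions. -/
def IsRun (r : List (Fin 3 × ℤ)) (ε : ℤ) : Prop := ∀ s ∈ r, s.1 ≠ 0 ∧ s.2 = ε

theorem IsRun.shear_eq {r : List (Fin 3 × ℤ)} {ε : ℤ} (h : IsRun r ε) :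
    shear r = (r.length * ε, 0) := by
  induction r with
  | nil => simp [shear]
  | cons s r ih =>
    have h1 := ih fun t ht => h t (List.mem_cons_of_mem _ ht)
    obtain ⟨h2, h3⟩ := h s List.mem_cons_self
    obtain ⟨i, e⟩ := s
    simp only [shear, Prod.mk.injEq] at h1 h2 h3 ⊢
    obtain ⟨h4, h5⟩ := h1
    fin_cases i
    · simp at h2
    · simp [h5, h3]; linear_combination h4
    · simp [h5, h3]; linear_combination h4

theorem IsRun.append {r r' : List (Fin 3 × ℤ)} {ε : ℤ} (h : IsRun r ε) (h' : IsRun r' ε) :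
    IsRun (r ++ r') ε := fun s hs => (List.mem_append.1 hs).elim (h s) (h' s)

theorem IsRun.visits {r : List (Fin 3 × ℤ)} {ε : ℤ} (h : IsRun r ε) (b : Fin 3 × ℤ)
    {s : ℕ} (hs : s ≤ r.length) : Visits (r ++ [b]) (s * ε, 0) := by
  refine ⟨s, by simp; omega, ?_⟩
  rw [List.take_append_of_le_length hs,
    IsRun.shear_eq (ε := ε) fun t ht => h t (List.mem_of_mem_take ht)]
  simp [hs]

/-- A run, a step in dimension `0`, and the run back visit two rows. -/
theorem visits_two_rows {r r' : List (Fin 3 × ℤ)} {ε δ : ℤ} (h : IsRun r ε)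
    (h' : IsRun r' (-ε)) (b : Fin 3 × ℤ) (hr : r.length = r'.length) {s : ℕ}
    (hs : s ≤ r.length) : Visits (r ++ [(0, δ)] ++ r' ++ [b]) (s * ε, 0) ∧
      Visits (r ++ [(0, δ)] ++ r' ++ [b]) (s * ε, δ) := by
  constructor
  · exact ((h.visits (0, δ) hs).append_right r').append_right [b]
  · have := (h'.visits b (s := r.length - s) (by omega)).append_left (r ++ [(0, δ)])
    rw [← List.append_assoc] at this
    convert this using 1
    rw [shear_append, h.shear_eq]
    simp [shear, Nat.cast_sub hs]
    ring

theorem hasLongCycle_of_visits {sz : Fin 3 → ℕ} {w : List (Fin 3 × ℤ)} {i k : Fin 3}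
    (hw : AltWord w i k) (hik : k ≠ i) (hdvd : sz 1 ∣ sz 2) (hpos : 0 < sz 2)
    (hlen : w.length = sz 1 * sz 0) (h0 : disp w 0 ≡ 0 [ZMOD sz 0])
    (h12 : disp w 1 + disp w 2 ≡ 0 [ZMOD sz 1]) (hcop : IsCoprime (disp w 2) (sz 2))
    (hcov : ∀ a < sz 1, ∀ b < sz 0, ∃ P, Visits w P ∧ P.1 ≡ a [ZMOD sz 1] ∧
      P.2 ≡ b [ZMOD sz 0]) :
    HasLongCycle sz 2 := by
  have hpos0 : 0 < w.length := by
    rcases w with _ | ⟨a, w⟩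
    · simpa using hw.head
    · simp
  have hs : 0 < sz 1 ∧ 0 < sz 0 := by simpa [hlen, Nat.pos_iff_ne_zero] using hpos0
  have hs1 : (0 : ℤ) < sz 1 := by exact_mod_cast hs.1
  have hs0 : (0 : ℤ) < sz 0 := by exact_mod_cast hs.2
  have hred : ∀ (v : ℤ) (n : ℕ), (0 : ℤ) < n → ∃ a < n, (a : ℤ) ≡ v [ZMOD n] := fun v n hn => by
    have h1 := Int.emod_nonneg v hn.ne'
    have h2 := Int.emod_lt_of_pos v hn
    refine ⟨(v % n).toNat, by omega, ?_⟩
    rw [Int.toNat_of_nonneg h1]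
    exact Int.mod_modEq _ _
  refine hasLongCycle_of_word hw hik (c := sz 2) ?_ ?_ fun v => ?_
  · rw [hlen, Fin.prod_univ_three]; ring
  · intro i
    fin_cases i
    · simpa using h0.mul_left (sz 2)
    · exact (Int.modEq_zero_iff_dvd.2 ((Int.natCast_dvd_natCast.2 hdvd).mul_right _))
    · exact (Int.modEq_zero_iff_dvd.2 (dvd_mul_right _ _))
  · obtain ⟨a, ha, hav⟩ := hred (v 1 + v 2) _ hs1
    obtain ⟨b, hb, hbv⟩ := hred (v 0) _ hs0
    obtain ⟨P, ⟨q, hq, rfl⟩, hPa, hPb⟩ := hcov a ha b hb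
    obtain ⟨n, hn⟩ := exists_nat_mul_modEq hpos hcop (v 2 - disp (w.take q) 2)
    have hn2 : (n : ℤ) * disp w 2 + disp (w.take q) 2 ≡ v 2 [ZMOD sz 2] := by
      simpa using hn.add_right (disp (w.take q) 2)
    refine ⟨n, q, hq, fun i => ?_⟩
    fin_cases i
    · simpa [shear] using (h0.mul_left n).add (hPb.trans hbv)
    · have h1 := (h12.mul_left n).add (hPa.trans hav)
      have h2 := h1.sub (hn2.of_dvd (Int.natCast_dvd_natCast.2 hdvd))
      simp only [shear] at h2
      refine Eq.trans ?_ (h2.trans ?_)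
      · congr 1; simp; ring
      · congr 1; simp
    · exact hn2

/-- The staircase word alternating `j` times between dimensions `1` and `2`. -/
def stair (j : ℕ) (ε : ℤ) : List (Fin 3 × ℤ) := (List.replicate j [(1, ε), (2, ε)]).flatten

@[simp] theorem stair_length (j : ℕ) (ε : ℤ) : (stair j ε).length = 2 * j := by
  simp [stair, Nat.mul_comm]

theorem stair_isRun (j : ℕ) (ε : ℤ) : IsRun (stair j ε) ε := by
  intro s hs
  simp only [stair, List.mem_flatten, List.mem_replicate] at hs
  obtain ⟨l, ⟨-, rfl⟩, hs⟩ := hs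
  simp only [List.mem_cons, List.not_mem_nil, or_false] at hs
  rcases hs with rfl | rfl <;> simp

@[simp] theorem shear_stair (j : ℕ) (ε : ℤ) : shear (stair j ε) = (2 * j * ε, 0) := by
  rw [(stair_isRun j ε).shear_eq]
  simp

@[simp] theorem disp_stair_zero (j : ℕ) (ε : ℤ) : disp (stair j ε) 0 = 0 := by simp [stair]

@[simp] theorem disp_stair_one (j : ℕ) (ε : ℤ) : disp (stair j ε) 1 = j * ε := by simp [stair]

@[simp] theorem disp_stair_two (j : ℕ) (ε : ℤ) : disp (stair j ε) 2 = j * ε := by simp [stair]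

theorem stair_altWord {j : ℕ} (hj : 1 ≤ j) {ε : ℤ} (hε : ε = 1 ∨ ε = -1) :
    AltWord (stair j ε) 1 2 := by
  have h : AltWord ([(1, ε), (2, ε)] : List (Fin 3 × ℤ)) 1 2 :=
    ⟨by simp, by simp, by simp, by simpa using hε⟩
  obtain ⟨j, rfl⟩ := Nat.exists_eq_add_of_le' hj
  simpa [stair, List.replicate_succ] using h.append_replicate h (by decide) j

theorem altWord_singleton {i : Fin 3} {ε : ℤ} (hε : ε = 1 ∨ ε = -1) :
    AltWord [(i, ε)] i i := ⟨by simp, by simp, by simp, by simpa using hε⟩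

theorem hasLongCycle_even {sz : Fin 3 → ℕ} {j h : ℕ} (hj : 1 ≤ j) (h1 : sz 1 = 2 * j + 2)
    (h0 : sz 0 = 2 * h + 2) (hdvd : sz 1 ∣ sz 2) (hpos : 0 < sz 2) : HasLongCycle sz 2 := by
  have hu : (1 : ℤ) = 1 ∨ (1 : ℤ) = -1 := Or.inl rfl
  have hu' : (-1 : ℤ) = 1 ∨ (-1 : ℤ) = -1 := Or.inr rfl
  have hz : AltWord [((0 : Fin 3), (1 : ℤ))] 0 0 := altWord_singleton hu
  set L : List (Fin 3 × ℤ) := stair j (-1) ++ [(1, -1)] with hL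
  set A : List (Fin 3 × ℤ) := [(2, 1)] ++ stair j 1 ++ [(0, 1)] ++ L ++ [(0, 1)] with hA
  set B : List (Fin 3 × ℤ) := stair j 1 ++ [(1, 1)] ++ [(0, 1)] ++ L ++ [(0, 1)] with hB
  have hLw : AltWord L 1 1 := (stair_altWord hj hu').append (altWord_singleton hu') (by decide)
  have hAw : AltWord A 2 0 :=
    (((((altWord_singleton hu).append (stair_altWord hj hu) (by decide)).append hz
      (by decide)).append hLw (by decide)).append hz (by decide))
  have hBw : AltWord B 1 0 :=
    (((((stair_altWord hj hu).append (altWord_singleton hu) (by decide)).append hz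
      (by decide)).append hLw (by decide)).append hz (by decide))
  have hw := hAw.append_replicate hBw (by decide) h
  have hLr : IsRun L (-1) := (stair_isRun _ _).append (by simp [IsRun])
  have hAr : IsRun ([(2, 1)] ++ stair j 1) 1 := IsRun.append (by simp [IsRun]) (stair_isRun _ _)
  have hBr : IsRun (stair j 1 ++ [(1, 1)]) 1 := (stair_isRun _ _).append (by simp [IsRun])
  have hAs : shear A = (0, 2) := by simp [hA, hL, shear]
  have hBs : shear B = (0, 2) := by simp [hB, hL, shear]
  refine hasLongCycle_of_visits hw (by decide) hdvd hpos ?_ ?_ ?_ ?_ ?_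
  · rw [h0, h1]; simp [hA, hB, hL]; ring
  · rw [h0, Int.modEq_zero_iff_dvd]
    exact ⟨1, by simp [hA, hB, hL]; ring⟩
  · rw [Int.modEq_zero_iff_dvd]
    exact ⟨0, by simp [hA, hB, hL]⟩
  · have : disp (A ++ (List.replicate h B).flatten) 2 = 1 := by simp [hA, hB, hL]
    rw [this]
    exact isCoprime_one_left
  · intro a ha b hb
    have hVA := visits_two_rows (δ := 1) hAr hLr (0, 1) (by simp [hL, Nat.add_comm]) (s := a)
      (by simp; omega)
    have hVB := visits_two_rows (δ := 1) hBr hLr (0, 1) (by simp [hL]) (s := a) (by simp; omega)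
    refine ⟨(a, b), ?_, rfl, rfl⟩
    rcases Nat.lt_or_ge b 2 with hb2 | hb2
    · interval_cases b
      · convert hVA.1.append_right (List.replicate h B).flatten using 1
        simp
      · convert hVA.2.append_right (List.replicate h B).flatten using 1
        simp
    · have hi : b / 2 - 1 < h := by omega
      rcases Nat.mod_two_eq_zero_or_one b with hb' | hb'
      · have := (Visits.flatten_replicate hVB.1 hi).append_left A
        rw [hAs, ← hB, hBs] at this
        convert this using 1
        simp
        omega
      · have := (Visits.flatten_replicate hVB.2 hi).append_left A
        rw [hAs, ← hB, hBs] at this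
        convert this using 1
        simp
        omega

theorem hasLongCycle_odd {sz : Fin 3 → ℕ} {j h : ℕ} (hj : 1 ≤ j) (h1 : sz 1 = 2 * j + 3)
    (h0 : sz 0 = 2 * h + 3) (hdvd : sz 1 ∣ sz 2) (hpos : 0 < sz 2)
    (hcop : Nat.Coprime (j + 2) (sz 2)) : HasLongCycle sz 2 := by
  have hu : (1 : ℤ) = 1 ∨ (1 : ℤ) = -1 := Or.inl rfl
  have hu' : (-1 : ℤ) = 1 ∨ (-1 : ℤ) = -1 := Or.inr rfl
  have hz : AltWord [((0 : Fin 3), (-1 : ℤ))] 0 0 := altWord_singleton hu'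
  set A : List (Fin 3 × ℤ) := [(2, 1)] ++ [(0, 1)] ++ [(1, -1)] ++ [(0, 1)] with hA
  set B : List (Fin 3 × ℤ) := [(1, 1)] ++ [(0, 1)] ++ [(1, -1)] ++ [(0, 1)] with hB
  set D : List (Fin 3 × ℤ) := stair (j + 1) 1 ++ [(0, -1)] with hD
  set S : List (Fin 3 × ℤ) := stair j (-1) ++ [(0, -1)] ++ stair j 1 with hS
  set T : List (Fin 3 × ℤ) := S ++ [(0, -1)] with hT
  set E : List (Fin 3 × ℤ) := S ++ [(1, 1)] with hE
  have hAw : AltWord A 2 0 := ⟨by simp [hA], by simp [hA], by simp [hA], by simp [hA]⟩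
  have hBw : AltWord B 1 0 := ⟨by simp [hB], by simp [hB], by simp [hB], by simp [hB]⟩
  have hDw : AltWord D 1 0 := (stair_altWord (by omega) hu).append hz (by decide)
  have hSw : AltWord S 1 2 := ((stair_altWord hj hu').append hz (by decide)).append
    (stair_altWord hj hu) (by decide)
  have hTw : AltWord T 1 0 := hSw.append hz (by decide)
  have hEw : AltWord E 1 1 := hSw.append (altWord_singleton hu) (by decide)
  have hw := (((hAw.append_replicate hBw (by decide) h).append hDw (by decide)).append_replicate
    hTw (by decide) h).append hEw (by decide)
  have hAs : shear A = (0, 2) := by simp [hA, shear]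
  have hBs : shear B = (0, 2) := by simp [hB, shear]
  have hDs : shear D = (2 * (j : ℤ) + 2, -1) := by simp [hD, shear]; ring
  have hTs : shear T = (0, -2) := by simp [hT, hS, shear]
  refine hasLongCycle_of_visits hw (by decide) hdvd hpos ?_ ?_ ?_ ?_ ?_
  · rw [h0, h1]; simp [hA, hB, hD, hT, hE, hS]; ring
  · rw [Int.modEq_zero_iff_dvd]
    exact ⟨0, by simp [hA, hB, hD, hT, hE, hS]; ring⟩
  · rw [h1, Int.modEq_zero_iff_dvd]
    exact ⟨1, by simp [hA, hB, hD, hT, hE, hS]; ring⟩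
  · rw [← Nat.isCoprime_iff_coprime] at hcop
    convert hcop using 1
    simp [hA, hB, hD, hT, hE, hS]; ring
  · intro a ha b hb
    refine ⟨(a, b), ?_, rfl, rfl⟩
    rcases Nat.lt_or_ge b (2 * h + 2) with hbh | hbh
    · rcases Nat.lt_or_ge a 2 with ha2 | ha2
      · have hVA := visits_two_rows (r := [(2, 1)]) (r' := [(1, -1)]) (ε := 1) (δ := 1)
          (by simp [IsRun]) (by simp [IsRun]) (0, 1) rfl (s := a) (by simp; omega)
        have hVB := visits_two_rows (r := [(1, 1)]) (r' := [(1, -1)]) (ε := 1) (δ := 1)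
          (by simp [IsRun]) (by simp [IsRun]) (0, 1) rfl (s := a) (by simp; omega)
        refine Visits.append_right (Visits.append_right (Visits.append_right ?_ _) _) _
        rcases Nat.lt_or_ge b 2 with hb2 | hb2
        · interval_cases b
          · convert hVA.1.append_right (List.replicate h B).flatten using 1
            simp
          · convert hVA.2.append_right (List.replicate h B).flatten using 1
            simp
        · have hi : b / 2 - 1 < h := by omega
          rcases Nat.mod_two_eq_zero_or_one b with hb' | hb'
          · have := (Visits.flatten_replicate hVB.1 hi).append_left A
            rw [hAs, ← hB, hBs] at this
            convert this using 1
            simp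
            omega
          · have := (Visits.flatten_replicate hVB.2 hi).append_left A
            rw [hAs, ← hB, hBs] at this
            convert this using 1
            simp
            omega
      · have hV := fun x => visits_two_rows (δ := -1) (stair_isRun j (-1)) (by
          simpa using stair_isRun j 1) x (by simp) (s := 2 * j + 2 - a) (by simp; omega)
        have hcast : ((2 * j + 2 - a : ℕ) : ℤ) = 2 * j + 2 - a := by omega
        rcases Nat.lt_or_ge b 2 with hb2 | hb2
        · interval_cases b
          · have := (hV (1, 1)).2.append_left
              (A ++ (List.replicate h B).flatten ++ D ++ (List.replicate h T).flatten)
            convert this using 1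
            simp [hAs, hBs, hDs, hTs, hcast]
          · have := (hV (1, 1)).1.append_left
              (A ++ (List.replicate h B).flatten ++ D ++ (List.replicate h T).flatten)
            convert this using 1
            simp [hAs, hBs, hDs, hTs, hcast]
        · have hi : (2 * h + 1 - b) / 2 < h := by omega
          refine Visits.append_right ?_ _
          rcases Nat.mod_two_eq_zero_or_one b with hb' | hb'
          · have := (Visits.flatten_replicate (hV (0, -1)).2 hi).append_left
              (A ++ (List.replicate h B).flatten ++ D)
            convert this using 1
            rw [← hS, ← hT, hTs]
            simp [hAs, hBs, hDs, hcast]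
            omega
          · have := (Visits.flatten_replicate (hV (0, -1)).1 hi).append_left
              (A ++ (List.replicate h B).flatten ++ D)
            convert this using 1
            rw [← hS, ← hT, hTs]
            simp [hAs, hBs, hDs, hcast]
            omega
    · refine Visits.append_right (Visits.append_right ?_ _) _
      have := ((stair_isRun (j + 1) 1).visits (0, -1) (s := a) (by simp; omega)).append_left
        (A ++ (List.replicate h B).flatten)
      convert this using 1
      simp [hAs, hBs]
      omega

/-- A closed word through all vertices of the `3 × 3 × 3` torus, winding around the last dimension
once in the negative direction. -/
def cubeWord : List (Fin 3 × ℤ) :=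
  [(0, 1), (1, 1), (0, 1), (1, -1), (2, 1), (0, 1), (1, 1), (0, 1), (2, 1), (0, 1), (2, -1),
    (1, 1), (0, 1), (2, -1), (1, -1), (2, -1), (1, 1), (0, 1), (1, 1), (2, -1), (1, -1), (2, -1),
    (0, 1), (2, -1), (1, 1), (0, 1), (2, 1)]

theorem cubeWord_covers : ∀ a b c : Fin 3, ∃ q < 27,
    disp (cubeWord.take q) 0 % 3 = (a : ℕ) ∧ disp (cubeWord.take q) 1 % 3 = (b : ℕ) ∧
      disp (cubeWord.take q) 2 % 3 = (c : ℕ) := by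
  decide +kernel

theorem hasLongCycle_three_three {sz : Fin 3 → ℕ} (h0 : sz 0 = 3) (h1 : sz 1 = 3)
    (h2 : 3 ∣ sz 2) (hpos : 0 < sz 2) : HasLongCycle sz 2 := by
  obtain ⟨c, hc⟩ := h2
  have hw : AltWord cubeWord 0 2 :=
    ⟨by simp [cubeWord], by simp [cubeWord], by simp [cubeWord], by simp [cubeWord]⟩
  have hD0 : disp cubeWord 0 = 9 := by decide +kernel
  have hD1 : disp cubeWord 1 = 3 := by decide +kernel
  have hD2 : disp cubeWord 2 = -3 := by decide +kernel
  refine hasLongCycle_of_word hw (by decide) (c := c) ?_ (fun i => ?_) fun v => ?_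
  · rw [Fin.prod_univ_three, h0, h1, hc, ← mul_assoc]
    rfl
  · rw [Int.modEq_zero_iff_dvd]
    fin_cases i
    · simp only [Fin.zero_eta, h0, hD0]; omega
    · simp only [Fin.mk_one, h1, hD1]; omega
    · simp only [Fin.reduceFinMk, hc, hD2]; exact ⟨-1, by push_cast; ring⟩
  · have hr : ∀ x : ℤ, ∃ a : Fin 3, x % 3 = (a : ℕ) := fun x =>
      ⟨⟨(x % 3).toNat, by omega⟩, by simp; omega⟩
    obtain ⟨a0, ha0⟩ := hr (v 0)
    obtain ⟨a1, ha1⟩ := hr (v 1)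
    obtain ⟨a2, ha2⟩ := hr (v 2)
    obtain ⟨q, hq, hq0, hq1, hq2⟩ := cubeWord_covers a0 a1 a2
    obtain ⟨t, ht⟩ : (3 : ℤ) ∣ disp (cubeWord.take q) 2 - v 2 := by omega
    obtain ⟨n, hn⟩ := exists_nat_mul_modEq (c := c) (by omega) isCoprime_one_left t
    obtain ⟨u, hu⟩ := hn.dvd
    refine ⟨n, q, hq, fun i => ?_⟩
    fin_cases i
    · simp only [Fin.zero_eta, h0, hD0, Int.ModEq]; omega
    · simp only [Fin.mk_one, h1, hD1, Int.ModEq]; omega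
    · simp only [Fin.reduceFinMk, hc, hD2]
      refine Int.modEq_iff_dvd.2 ⟨-u, ?_⟩
      push_cast
      linear_combination -ht - 3 * hu

theorem HasLongCycle.sum_prime_pow {ι κ : Type} [Fintype ι] [Fintype κ] {sz : ι → ℕ}
    {sz' : κ → ℕ} {L₁ L₂ p a b : ℕ} (hp : p.Prime) (h₁ : HasLongCycle sz L₁)
    (h₂ : HasLongCycle sz' L₂) (ha : ∏ i, sz i = p ^ a) (hb : ∏ i, sz' i = p ^ b)
    (hL₁ : 1 ≤ L₁) (hL₂ : 1 ≤ L₂) (hle : 2 * (L₁ + L₂ - 1) ≤ ∏ i, sz i) (hab : a ≤ b) :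
    HasLongCycle (Sum.elim sz sz') (L₁ + L₂ - 1) := by
  set L := L₁ + L₂ - 1 with hL
  set d := ∏ i, sz i with hd
  have hLpos : 0 < L := by omega
  have hpd : p ∣ d := by
    rw [ha]
    refine dvd_pow_self p ?_
    rintro rfl
    rw [pow_zero] at ha
    omega
  set s₀ := (L₁ - 1) * d / L with hs₀
  have h1 : (L₁ - 1) * d < L * (s₀ + 1) := Nat.lt_mul_div_succ _ hLpos
  have h2 : L * s₀ ≤ (L₁ - 1) * d := Nat.mul_div_le _ _
  have h3 : (L₁ - 1) * d + d = L₁ * d := by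
    obtain ⟨l, rfl⟩ := Nat.exists_eq_add_of_le' hL₁
    simp only [Nat.add_sub_cancel]; ring
  obtain ⟨s, hs, hlow, hup⟩ : ∃ s, ¬ p ∣ s ∧ (L₁ - 1) * d ≤ L * s ∧ L * s ≤ L₁ * d := by
    by_cases h : p ∣ s₀ + 1
    · refine ⟨s₀ + 1 + 1, fun h' => hp.one_lt.ne' ?_, ?_, ?_⟩
      · exact Nat.dvd_one.1 ((Nat.dvd_add_right h).1 h')
      · nlinarith
      · nlinarith
    · exact ⟨s₀ + 1, h, h1.le, by nlinarith⟩
  have hsd : s ≤ d := by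
    refine Nat.le_of_mul_le_mul_left (hup.trans ?_) hLpos
    exact Nat.mul_le_mul_right _ (by omega)
  have hst : s + (d - s) = d := Nat.add_sub_cancel' hsd
  refine h₁.sum h₂ hst ?_ ?_ ?_ (hst.symm ▸ hlow) (hst.symm ▸ hup) hL₁ hL₂
  · rw [← hd, ha, hb]; exact pow_dvd_pow p hab
  · rw [hb]; exact pow_pos hp.pos _
  · rw [hb]
    refine Nat.Coprime.pow_right _ ((hp.coprime_iff_not_dvd.2 fun h => hs ?_).symm)
    exact (Nat.dvd_add_left h).1 (hst.symm ▸ hpd)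

theorem hasLongCycle_fin_three {p : ℕ} (hp : p.Prime) (sz : Fin 3 → ℕ) (hsz : ∀ i, 3 ≤ sz i)
    (hpow : ∀ i, ∃ k, sz i = p ^ k) : HasLongCycle sz 2 := by
  refine HasLongCycle.of_comp_equiv (Tuple.sort sz) ?_
  have hmono := Tuple.monotone_sort sz
  set sz' := sz ∘ Tuple.sort sz
  have hsz' : ∀ i, 3 ≤ sz' i := fun i => hsz _
  have hpow' : ∀ i, ∃ k, sz' i = p ^ k := fun i => hpow _
  have hdvd : ∀ i j, i ≤ j → sz' i ∣ sz' j := fun i j hij => by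
    obtain ⟨k, hk⟩ := hpow' i
    obtain ⟨l, hl⟩ := hpow' j
    have := hmono hij
    rw [hk, hl] at this ⊢
    exact pow_dvd_pow p ((Nat.pow_le_pow_iff_right hp.one_lt).1 this)
  have hp_dvd : ∀ i, p ∣ sz' i := fun i => by
    obtain ⟨k, hk⟩ := hpow' i
    rw [hk]
    refine dvd_pow_self p ?_
    rintro rfl
    have := hsz' i
    rw [hk, pow_zero] at this
    omega
  have hpos : 0 < sz' 2 := by have := hsz' 2; omega
  have h3 := hsz' 0
  have h3' := hsz' 1
  rcases hp.eq_two_or_odd' with rfl | hodd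
  · obtain ⟨m, hm⟩ := hp_dvd 1
    obtain ⟨a, ha⟩ := hp_dvd 0
    exact hasLongCycle_even (j := m - 1) (h := a - 1) (by omega) (by omega) (by omega)
      (hdvd 1 2 (by decide)) hpos
  · have hodd' : ∀ i, sz' i % 2 = 1 := fun i => by
      obtain ⟨k, hk⟩ := hpow' i
      rw [hk]
      exact Nat.odd_iff.1 hodd.pow
    have h4 := hodd' 0
    have h5 := hodd' 1
    rcases Nat.lt_or_ge (sz' 1) 4 with h | h
    · have hle := hmono (show (0 : Fin 3) ≤ 1 by decide)
      refine hasLongCycle_three_three (by omega) (by omega) ?_ hpos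
      have h6 : sz' 1 = 3 := by omega
      have h7 := hdvd 1 2 (by decide)
      rwa [h6] at h7
    · refine hasLongCycle_odd (j := (sz' 1 - 3) / 2) (h := (sz' 0 - 3) / 2) (by omega) (by omega)
        (by omega) (hdvd 1 2 (by decide)) hpos ?_
      obtain ⟨k, hk⟩ := hpow' 2
      rw [hk]
      refine Nat.Coprime.pow_right _ ((hp.coprime_iff_not_dvd.2 fun h => ?_).symm)
      have h7 : 2 * ((sz' 1 - 3) / 2 + 2) = sz' 1 + 1 := by omega
      exact hp.one_lt.ne' (Nat.dvd_one.1 ((Nat.dvd_add_right (hp_dvd 1)).1 (h7 ▸ h.mul_left 2)))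

theorem hasLongCycle_of_prime_pow {p : ℕ} (hp : p.Prime) (n : ℕ) (hn : 1 ≤ n)
    (sz : Fin (3 * n) → ℕ) (hsz : ∀ i, 3 ≤ sz i) (hpow : ∀ i, ∃ k, sz i = p ^ k) :
    HasLongCycle sz (n + 1) := by
  induction n using Nat.strong_induction_on with
  | _ n ih =>
  rcases Nat.lt_or_ge n 2 with hn2 | hn2
  · obtain rfl : n = 1 := by omega
    exact hasLongCycle_fin_three hp sz hsz hpow
  have hprod : ∀ {k : ℕ} (s : Fin k → ℕ), (∀ i, ∃ l, s i = p ^ l) → ∃ a, ∏ i, s i = p ^ a := by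
    intro k s hs
    choose l hl using hs
    exact ⟨∑ i, l i, by simp_rw [hl, Finset.prod_pow_eq_pow_sum]⟩
  have hbig : ∀ {m : ℕ} (s : Fin (3 * m) → ℕ), n ≤ 2 * m + 1 → (∀ i, 3 ≤ s i) →
      2 * (n + 1) ≤ ∏ i, s i := fun {m} s hm hs => by
    have h1 : 3 ^ (3 * m) ≤ ∏ i, s i := by
      simpa using Finset.pow_card_le_prod Finset.univ s 3 fun i _ => hs i
    have h2 : ∀ m : ℕ, 1 ≤ m → 4 * m + 4 ≤ 3 ^ (3 * m) := fun m hm => by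
      induction m, hm using Nat.le_induction with
      | base => norm_num
      | succ m _ ih => rw [show 3 * (m + 1) = 3 * m + 3 by ring, pow_add]; omega
    have := h2 m (by omega)
    omega
  obtain ⟨n₁, n₂, h₁, h₂, hsum, hle, hle'⟩ : ∃ n₁ n₂, 1 ≤ n₁ ∧ 1 ≤ n₂ ∧ n = n₁ + n₂ ∧
      n ≤ 2 * n₁ + 1 ∧ n ≤ 2 * n₂ + 1 := ⟨n / 2, n - n / 2, by omega, by omega, by omega,
    by omega, by omega⟩
  let g : Fin (3 * n₁) ⊕ Fin (3 * n₂) ≃ Fin (3 * n) :=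
    finSumFinEquiv.trans (finCongr (by rw [hsum]; ring))
  refine HasLongCycle.of_comp_equiv g ?_
  set u := sz ∘ g ∘ Sum.inl
  set v := sz ∘ g ∘ Sum.inr
  have huv : sz ∘ g = Sum.elim u v := (Sum.elim_comp_inl_inr _).symm
  have hu := ih n₁ (by omega) h₁ u (fun i => hsz _) fun i => hpow _
  have hv := ih n₂ (by omega) h₂ v (fun i => hsz _) fun i => hpow _
  obtain ⟨a, ha⟩ := hprod u fun i => hpow _
  obtain ⟨b, hb⟩ := hprod v fun i => hpow _
  have hubig := hbig u hle fun i => hsz _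
  have hvbig := hbig v hle' fun i => hsz _
  rw [huv]
  rcases Nat.le_total a b with hab | hab
  · have := hu.sum_prime_pow hp hv ha hb (by omega) (by omega) (by omega) hab
    rwa [show n₁ + 1 + (n₂ + 1) - 1 = n + 1 by omega] at this
  · have := hv.sum_prime_pow hp hu hb ha (by omega) (by omega) (by omega) hab
    rw [show n₂ + 1 + (n₁ + 1) - 1 = n + 1 by omega] at this
    refine HasLongCycle.of_comp_equiv (Equiv.sumComm _ _) ?_
    convert this using 1
    ext (i | i) <;> rfl

theorem WindowOk.le_torusCard {k : ℕ} {sz : Fin k → ℕ} (hsz : ∀ i, 2 ≤ sz i)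
    {f : ZMod (torusCard k sz) → TorusVtx k sz} (hf : IsHamCycle f) {r : ℕ}
    (h : WindowOk f r) : r ≤ torusCard k sz := by
  by_contra! hlt
  have hpos : 0 < torusCard k sz := Finset.prod_pos fun i _ => by have := hsz i; omega
  obtain ⟨i, hi, -⟩ := hf.2 0
  have : Fact (1 < sz i) := ⟨hsz i⟩
  have hedge : EdgeInDim f i 0 := fun heq => by
    rw [heq] at hi
    simp at hi
  exact h 0 i 0 (torusCard k sz) (by omega) hlt hpos.ne (by simpa using hedge)

theorem HasLongCycle.le_mrl {k : ℕ} {sz : Fin k → ℕ} (hsz : ∀ i, 2 ≤ sz i) {L : ℕ}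
    (hL : 1 ≤ L) (h : HasLongCycle sz L) : L ≤ mrl k sz := by
  obtain ⟨f, e, h⟩ := h
  have hpos : 0 < torusCard k sz := Finset.prod_pos fun i _ => by have := hsz i; omega
  have : NeZero (torusCard k sz) := ⟨hpos.ne'⟩
  have (i : Fin k) : NeZero (sz i) := ⟨by have := hsz i; omega⟩
  let F : ZMod (torusCard k sz) → TorusVtx k sz := fun t i => (f t.val i : ZMod (sz i))
  have hF : ∀ (n : ℕ) i, F n i = (f n i : ZMod (sz i)) := fun n i => by
    refine (ZMod.intCast_eq_intCast_iff _ _ _).2 (h.congr_of_modEq ?_ i)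
    rw [ZMod.val_natCast]
    exact Nat.mod_modEq _ _
  have hF' : ∀ (n : ℕ) i, F (n + 1) i = (f (n + 1) i : ZMod (sz i)) := fun n i => by
    rw [← hF]; push_cast; rfl
  have hedge : ∀ (n : ℕ) i, EdgeInDim F i n → e n = i := fun n i hi => by
    by_contra hne
    refine hi ?_
    rw [hF, hF', (h.step n).2 i (Ne.symm hne)]
  have hham : IsHamCycle F := by
    refine ⟨?_, fun t => ?_⟩
    · have hcard : Nat.card (TorusVtx k sz) = torusCard k sz := by
        unfold TorusVtx
        simp [torusCard]
      refine Function.Surjective.bijective_of_nat_card_le (fun v => ?_) (by simp [hcard])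
      obtain ⟨t, ht⟩ := h.surj fun i => ((v i).val : ℤ)
      refine ⟨t, funext fun i => ?_⟩
      rw [hF, (ZMod.intCast_eq_intCast_iff _ _ _).2 (ht i)]
      simp
    · obtain ⟨n, rfl⟩ := ZMod.natCast_zmod_surjective t
      obtain ⟨h1, h2⟩ := h.step n
      refine ⟨e n, ?_, fun j hj => by rw [hF, hF', h2 j hj]⟩
      rw [hF, hF']
      rcases h1 with h1 | h1
      · left; rw [h1]; push_cast; rfl
      · right; rw [h1]; push_cast; rfl
  have hwin : WindowOk F L := fun t i a b ha hb hab ⟨hia, hib⟩ => by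
    obtain ⟨n, rfl⟩ := ZMod.natCast_zmod_surjective t
    rw [← Nat.cast_add] at hia hib
    have hea := hedge _ _ hia
    have heb := hedge _ _ hib
    rcases Nat.lt_or_gt_of_ne hab with hlt | hlt
    · have := h.gap (n + a) (b - a) (by omega) (by omega)
      rw [show n + a + (b - a) = n + b by omega] at this
      exact this (heb.trans hea.symm)
    · have := h.gap (n + b) (a - b) (by omega) (by omega)
      rw [show n + b + (a - b) = n + a by omega] at this
      exact this (hea.trans heb.symm)
  have hrun : L ≤ runLength F :=
    le_csSup ⟨torusCard k sz, fun r hr => hr.2.le_torusCard hsz hham⟩ ⟨hL, hwin⟩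
  refine hrun.trans (le_csSup ⟨torusCard k sz, ?_⟩ ⟨F, hham, rfl⟩)
  rintro m ⟨f', hf', rfl⟩
  exact csSup_le' fun r hr => hr.2.le_torusCard hsz hf'

/-- **Application 2.**  Let `p` be a prime, `n ≥ 1`, and let
`G = γ₁ × ⋯ × γ_{3n}` be a torus with `3n` dimensions such that `|G| = p^r`
for some positive integer `r`.  Then `mrl(G) ≥ n + 1`. -/
theorem mrl_prime_power_three_n
    (p : ℕ) (hp : p.Prime) (n : ℕ) (hn : 1 ≤ n)
    (sz : Fin (3 * n) → ℕ) (hsz : ∀ i, 3 ≤ sz i)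
    (hcard : ∃ r : ℕ, 0 < r ∧ torusCard (3 * n) sz = p ^ r) :
    n + 1 ≤ mrl (3 * n) sz := by
  obtain ⟨r, -, hr⟩ := hcard
  refine (hasLongCycle_of_prime_pow hp n hn sz hsz fun i => ?_).le_mrl
    (fun i => (hsz i).trans' (by norm_num)) (by omega)
  obtain ⟨k, -, hk⟩ := (Nat.dvd_prime_pow hp).1
    (hr ▸ Finset.dvd_prod_of_mem sz (Finset.mem_univ i) : sz i ∣ p ^ r)
  exact ⟨k, hk⟩
end

section
/- Let p be a prime, n ≥ 1, and let G = γ₁ × γ₂ × ⋯ × γ_{2n} be a torus with 2n dimensions such that for each i the number of vertices of γ_i equals 2^{q_i}·p^{r_i} for some integers q_i ≥ 1 and r_i ≥ 0. Then mrl(G) ≥ n + 1. -/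
/-- An integer lift of a Hamiltonian cycle in the subtorus spanned by the dimensions in `S`:
`f t` is the `t`-th vertex, `w t` the dimension of the edge from `f t` to `f (t + 1)`, and any
`n + 1` consecutive edges have distinct dimensions. -/
structure IsLongRunCycle {ι : Type*} (sz : ι → ℕ) (S : Finset ι) (n : ℕ)
    (f : ℤ → ι → ℤ) (w : ℤ → ι) : Prop where
  mem : ∀ t, w t ∈ S
  step : ∀ t, f (t + 1) (w t) = f t (w t) + 1 ∨ f t (w t) = f (t + 1) (w t) + 1
  stay : ∀ t i, i ≠ w t → f (t + 1) i = f t i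
  modEq_iff : ∀ s t, (∀ i ∈ S, f s i ≡ f t i [ZMOD sz i]) ↔ s ≡ t [ZMOD (∏ i ∈ S, sz i : ℕ)]
  window : ∀ t c, 0 < c → c ≤ (n : ℤ) → w (t + c) ≠ w t

/-- A two-dimensional torus with even side lengths has a Hamiltonian cycle turning at every
vertex. -/
theorem exists_isLongRunCycle_pair {ι : Type*} [DecidableEq ι] (sz : ι → ℕ) {a b : ι} (hab : a ≠ b)
    (ha : 2 ∣ sz a) (hb : 2 ∣ sz b) (ha0 : 0 < sz a) :
    ∃ f w, IsLongRunCycle sz {a, b} 1 f w := by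
  obtain ⟨x, hx⟩ := ha
  obtain ⟨y, hy⟩ := hb
  have hx0 : (0 : ℤ) < x := by omega
  refine ⟨fun t i => if i = a then (t + 1) / 2 else if i = b then
    2 * ((t / 2) / (sz a : ℤ)) + (t / 2) % 2 else 0,
    fun t => if t % 2 = 0 then a else b, ?_, ?_, ?_, ?_, ?_⟩
  · intro t
    split_ifs <;> simp
  · intro t
    by_cases ht : t % 2 = 0
    · simp only [ht, if_true]
      omega
    · simp only [ht, if_false, hab.symm, if_true]
      have h2 : (t + 1) / 2 = t / 2 + 1 := by omega
      rw [h2]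
      generalize t / 2 = s
      rw [hx]
      push_cast
      have hd := Int.mul_ediv_add_emod s (2 * x)
      have h0 := Int.emod_nonneg s (show (2 * x : ℤ) ≠ 0 by omega)
      have h1 := Int.emod_lt_of_pos s (show (0 : ℤ) < 2 * x by omega)
      have hpar : s % (2 * x) % 2 = s % 2 := Int.emod_emod_of_dvd s (Dvd.intro _ rfl)
      by_cases hr : s % (2 * x) + 1 < 2 * x
      · have : (s + 1) / (2 * x : ℤ) = s / (2 * x) := by
          rw [Int.ediv_eq_iff_of_pos (by omega)]
          constructor <;> linarith
        rw [this]
        omega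
      · have : (s + 1) / (2 * x : ℤ) = s / (2 * x) + 1 := by
          rw [Int.ediv_eq_iff_of_pos (by omega)]
          constructor <;> linarith
        rw [this]
        omega
  · intro t i hi
    by_cases ht : t % 2 = 0
    · simp only [ht, if_true] at hi
      have : (t + 1) / 2 = t / 2 := by omega
      simp only [hi, if_false, this]
    · simp only [ht, if_false] at hi
      have : (t + 1 + 1) / 2 = (t + 1) / 2 := by omega
      simp only [hi, if_false, this]
  · intro s t
    rw [Finset.prod_pair hab]
    simp only [Finset.mem_insert, Finset.mem_singleton, forall_eq_or_imp, forall_eq, if_true,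
      hab.symm, if_false]
    constructor
    · rintro ⟨h1, h2⟩
      rw [Int.modEq_iff_dvd] at h1 h2 ⊢
      obtain ⟨k, hk⟩ := h1
      obtain ⟨l, hl⟩ := h2
      have hpar : s % 2 = t % 2 := by
        rw [hx] at hk
        rw [hy] at hl
        push_cast at hk hl
        rw [mul_assoc] at hk hl
        omega
      have huv : t / 2 = s / 2 + sz a * k := by omega
      have hdiv : (t / 2) / (sz a : ℤ) = (s / 2) / sz a + k := by
        rw [huv, Int.add_mul_ediv_left _ _ (by omega)]
      have hmod : t / 2 % 2 = s / 2 % 2 := by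
        rw [huv, hx]
        push_cast
        rw [mul_assoc]
        omega
      have hkl : 2 * k = sz b * l := by rw [← hl, hdiv, hmod]; ring
      refine ⟨l, ?_⟩
      push_cast
      rw [mul_assoc, ← hkl]
      linarith [show t - s = 2 * (t / 2 - s / 2) by omega]
    · intro h
      rw [Int.modEq_iff_dvd] at h
      obtain ⟨k, hk⟩ := h
      have hts : t = s + 2 * (sz a * (y * k)) := by
        rw [hy] at hk
        push_cast at hk
        linear_combination hk
      have hdiv2 : t / 2 = s / 2 + sz a * (y * k) := by omega
      constructor
      · rw [Int.modEq_iff_dvd]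
        exact ⟨y * k, by omega⟩
      · rw [Int.modEq_iff_dvd]
        refine ⟨k, ?_⟩
        have hmod : t / 2 % 2 = s / 2 % 2 := by
          rw [hdiv2, hx]
          push_cast
          rw [mul_assoc]
          omega
        rw [hmod, hdiv2, Int.add_mul_ediv_left _ _ (by omega), hy]
        push_cast
        ring
  · intro t c hc0 hc1
    obtain rfl : c = 1 := by push_cast at hc1; omega
    by_cases ht : t % 2 = 0
    · have : (t + 1) % 2 ≠ 0 := by omega
      simpa [ht, this] using hab.symm
    · have : (t + 1) % 2 = 0 := by omega
      simpa [ht, this] using hab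

/-- Interleaving long-run cycles of two subtori: the first one advances `d₁` times and the second
one `d₂` times in any `d = d₁ + d₂` consecutive steps, as evenly as possible. -/
theorem IsLongRunCycle.exists_union {ι : Type*} [DecidableEq ι] {sz : ι → ℕ} {S₁ S₂ : Finset ι}
    {n₁ n₂ : ℕ} {f₁ f₂ : ℤ → ι → ℤ} {w₁ w₂ : ℤ → ι}
    (h₁ : IsLongRunCycle sz S₁ n₁ f₁ w₁) (h₂ : IsLongRunCycle sz S₂ n₂ f₂ w₂)
    (hS : Disjoint S₁ S₂) {d₁ d₂ : ℕ} (hpos : 0 < d₁ + d₂)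
    (hd : d₁ + d₂ = Nat.gcd (∏ i ∈ S₁, sz i) (∏ i ∈ S₂, sz i))
    (hc₁ : d₁.Coprime (∏ i ∈ S₁, sz i)) (hc₂ : d₂.Coprime (∏ i ∈ S₂, sz i))
    (hw₁ : (n₁ + n₂ + 1) * d₁ ≤ (n₁ + 1) * (d₁ + d₂))
    (hw₂ : (n₁ + n₂ + 1) * d₂ ≤ (n₂ + 1) * (d₁ + d₂)) :
    ∃ f w, IsLongRunCycle sz (S₁ ∪ S₂) (n₁ + n₂) f w := by
  set M₁ := ∏ i ∈ S₁, sz i with hM₁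
  set M₂ := ∏ i ∈ S₂, sz i with hM₂
  obtain ⟨d, hdd⟩ : ∃ d : ℤ, d = d₁ + d₂ := ⟨_, rfl⟩
  have hd0 : 0 < d := by omega
  obtain ⟨A, hA⟩ : ∃ A : ℤ → ℤ, ∀ t, A t = t * d₁ / d := ⟨_, fun _ => rfl⟩
  have hAle (t : ℤ) : d * A t ≤ t * d₁ := by rw [hA]; exact Int.mul_ediv_self_le hd0.ne'
  have hAlt (t : ℤ) : t * d₁ < d * A t + d := by
    rw [hA]; exact Int.lt_mul_ediv_self_add hd0
  have hAshift (t k : ℤ) : A (t + d * k) = A t + k * d₁ := by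
    rw [hA, hA, show (t + d * k) * d₁ = t * d₁ + d * (k * d₁) by ring,
      Int.add_mul_ediv_left _ _ hd0.ne']
  have hAsucc (t : ℤ) : A (t + 1) = A t ∨ A (t + 1) = A t + 1 := by
    have e1 := hAle t
    have e2 := hAlt t
    have e3 := hAle (t + 1)
    have e4 := hAlt (t + 1)
    have l : A t < A (t + 1) + 1 := by
      refine lt_of_mul_lt_mul_left ?_ hd0.le
      linarith
    have u : A (t + 1) < A t + 2 := by
      refine lt_of_mul_lt_mul_left ?_ hd0.le
      linarith
    omega
  have key (s t : ℤ) : (A s ≡ A t [ZMOD M₁] ∧ s - A s ≡ t - A t [ZMOD M₂]) ↔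
      s ≡ t [ZMOD (M₁ * M₂ : ℕ)] := by
    have hdM₁ : d ∣ (M₁ : ℤ) := by
      rw [hdd]; exact_mod_cast hd ▸ Nat.gcd_dvd_left M₁ M₂
    have hdM₂ : d ∣ (M₂ : ℤ) := by
      rw [hdd]; exact_mod_cast hd ▸ Nat.gcd_dvd_right M₁ M₂
    have hlcm : (M₁ * M₂ : ℤ) = d * (Nat.lcm M₁ M₂ : ℕ) := by
      rw [hdd]; exact_mod_cast hd ▸ (Nat.gcd_mul_lcm M₁ M₂).symm
    constructor
    · rintro ⟨e1, e2⟩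
      have e : s ≡ t [ZMOD d] := by
        simpa using (e1.of_dvd hdM₁).add (e2.of_dvd hdM₂)
      obtain ⟨k, hk⟩ := e.dvd
      obtain rfl : t = s + d * k := by linarith
      rw [hAshift, Int.modEq_iff_dvd] at e1 e2
      have f1 : (M₁ : ℤ) ∣ k := by
        rw [add_sub_cancel_left] at e1
        exact (Int.isCoprime_iff_gcd_eq_one.2 (by simpa using hc₁.symm)).dvd_of_dvd_mul_right e1
      have f2 : (M₂ : ℤ) ∣ k := by
        rw [show s + d * k - (A s + k * d₁) - (s - A s) = k * d₂ by rw [hdd]; ring] at e2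
        exact (Int.isCoprime_iff_gcd_eq_one.2 (by simpa using hc₂.symm)).dvd_of_dvd_mul_right e2
      have f3 : ((Nat.lcm M₁ M₂ : ℕ) : ℤ) ∣ k := by
        rw [Int.natCast_dvd] at *
        exact Nat.lcm_dvd f1 f2
      rw [Int.modEq_iff_dvd]
      push_cast
      rw [hlcm, add_sub_cancel_left]
      exact mul_dvd_mul_left _ f3
    · intro e
      obtain ⟨k, hk⟩ := e.dvd
      push_cast at hk
      rw [hlcm] at hk
      obtain rfl : t = s + d * ((Nat.lcm M₁ M₂ : ℕ) * k) := by linarith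
      rw [hAshift, Int.modEq_iff_dvd, Int.modEq_iff_dvd]
      have f1 : (M₁ : ℤ) ∣ (Nat.lcm M₁ M₂ : ℕ) := by exact_mod_cast Nat.dvd_lcm_left M₁ M₂
      have f2 : (M₂ : ℤ) ∣ (Nat.lcm M₁ M₂ : ℕ) := by exact_mod_cast Nat.dvd_lcm_right M₁ M₂
      constructor
      · rw [add_sub_cancel_left, mul_assoc]
        exact f1.mul_right _
      · rw [show s + d * ((Nat.lcm M₁ M₂ : ℕ) * k) - (A s + (Nat.lcm M₁ M₂ : ℕ) * k * d₁)
          - (s - A s) = (Nat.lcm M₁ M₂ : ℕ) * (k * d₂) by rw [hdd]; ring]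
        exact f2.mul_right _
  have hnot {i : ι} (hi : i ∈ S₂) : i ∉ S₁ := fun h => Finset.disjoint_left.1 hS h hi
  refine ⟨fun t i => if i ∈ S₁ then f₁ (A t) i else f₂ (t - A t) i,
    fun t => if A (t + 1) = A t then w₂ (t - A t) else w₁ (A t), ?_, ?_, ?_, ?_, ?_⟩
  · intro t
    split_ifs
    · exact Finset.mem_union_right _ (h₂.mem _)
    · exact Finset.mem_union_left _ (h₁.mem _)
  · intro t
    rcases hAsucc t with h | h
    · have := h₂.step (t - A t)
      simpa [h, hnot (h₂.mem _), add_sub_right_comm] using this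
    · have := h₁.step (A t)
      simpa [h, h₁.mem _] using this
  · intro t i hi
    rcases hAsucc t with h | h
    · simp only [h, if_true] at hi ⊢
      split_ifs
      · rfl
      · rw [add_sub_right_comm]
        exact h₂.stay _ _ hi
    · have hne : A t + 1 ≠ A t := by omega
      simp only [h, hne, if_false, add_sub_add_right_eq_sub] at hi ⊢
      split_ifs
      · exact h₁.stay _ _ hi
      · rfl
  · intro s t
    rw [Finset.prod_union hS, ← key, ← h₁.modEq_iff, ← h₂.modEq_iff]
    constructor
    · intro h
      exact ⟨fun i hi => by simpa [hi] using h i (Finset.mem_union_left _ hi),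
        fun i hi => by simpa [hnot hi] using h i (Finset.mem_union_right _ hi)⟩
    · rintro ⟨e1, e2⟩ i hi
      by_cases hi1 : i ∈ S₁
      · simpa [hi1] using e1 i hi1
      · simpa [hi1] using e2 i ((Finset.mem_union.1 hi).resolve_left hi1)
  · intro t c hc0 hc
    have hcn : c + 1 ≤ n₁ + n₂ + 1 := by push_cast at hc; omega
    have hmono : A (t + 1) ≤ A (t + c) := by
      rw [hA, hA]
      refine Int.ediv_le_ediv hd0 (mul_le_mul_of_nonneg_right ?_ (by positivity))
      omega
    have hmonoB : t + 1 - A (t + 1) ≤ t + c - A (t + c) := by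
      have e3 := hAlt (t + 1)
      have e4 := hAle (t + c)
      have : A (t + c) - A (t + 1) < c - 1 + 1 := by
        refine lt_of_mul_lt_mul_left ?_ hd0.le
        have : 0 ≤ (c - 1) * d₂ := mul_nonneg (by omega) (by positivity)
        have : d * (c - 1) = (c - 1) * d₁ + (c - 1) * d₂ := by rw [hdd]; ring
        linarith
      omega
    have hw₁' : ((n₁ + n₂ + 1 : ℤ)) * d₁ ≤ (n₁ + 1) * d := by rw [hdd]; exact_mod_cast hw₁
    have hw₂' : ((n₁ + n₂ + 1 : ℤ)) * d₂ ≤ (n₂ + 1) * d := by rw [hdd]; exact_mod_cast hw₂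
    have e2 := hAlt t
    have e1 := hAle t
    have e3 := hAle (t + c + 1)
    have e4 := hAlt (t + c + 1)
    have hcount₁ : A (t + c + 1) < A t + (n₁ + 2) := by
      refine lt_of_mul_lt_mul_left ?_ hd0.le
      have := mul_le_mul_of_nonneg_right hcn (show (0 : ℤ) ≤ d₁ by positivity)
      linarith
    have hcount₂ : (t + c + 1 - A (t + c + 1)) < t - A t + (n₂ + 2) := by
      refine lt_of_mul_lt_mul_left ?_ hd0.le
      have := mul_le_mul_of_nonneg_right hcn (show (0 : ℤ) ≤ d₂ by positivity)
      have : d * (c + 1) = (c + 1) * d₁ + (c + 1) * d₂ := by rw [hdd]; ring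
      linarith
    rcases hAsucc t with h | h <;> rcases hAsucc (t + c) with h' | h'
    · simp only [h, h', if_true]
      have := h₂.window (t - A t) (t + c - A (t + c) - (t - A t)) (by omega) (by omega)
      rwa [add_sub_cancel] at this
    · have hne : A (t + c) + 1 ≠ A (t + c) := by omega
      simp only [h, h', hne, if_true, if_false]
      exact fun e => hnot (h₂.mem (t - A t)) (e ▸ h₁.mem _)
    · have hne : A t + 1 ≠ A t := by omega
      simp only [h, h', hne, if_true, if_false]
      exact fun e => hnot (h₂.mem (t + c - A (t + c))) (e ▸ h₁.mem _)
    · have hne : A (t + c) + 1 ≠ A (t + c) := by omega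
      have hne' : A t + 1 ≠ A t := by omega
      simp only [h, h', hne, hne', if_false]
      have := h₁.window (A t) (A (t + c) - A t) (by omega) (by omega)
      rwa [add_sub_cancel] at this

theorem coprime_prod_of_two_pow_mul_prime_pow {ι : Type*} {sz : ι → ℕ} {p : ℕ} (hp : p.Prime)
    (hform : ∀ i, ∃ q r : ℕ, 1 ≤ q ∧ sz i = 2 ^ q * p ^ r) {S : Finset ι} {c : ℕ}
    (h2 : ¬ 2 ∣ c) (hc : ¬ p ∣ c ∨ ∀ i ∈ S, ¬ p ∣ sz i) : c.Coprime (∏ i ∈ S, sz i) := by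
  refine Nat.Coprime.prod_right fun i hi => ?_
  have h2' : Nat.Coprime c 2 := ((Nat.Prime.coprime_iff_not_dvd Nat.prime_two).2 h2).symm
  obtain ⟨q, r, -, hqr⟩ := hform i
  rw [hqr]
  refine Nat.Coprime.mul_right (h2'.pow_right q) ?_
  rcases hc with hc | hc
  · exact (((Nat.Prime.coprime_iff_not_dvd hp).2 hc).symm).pow_right r
  · rcases r with _ | r
    · simp
    · exact absurd (hqr ▸ (dvd_pow_self p r.succ_ne_zero).mul_left _) (hc i hi)

theorem pow_card_dvd_prod {ι : Type*} {sz : ι → ℕ} {S : Finset ι} {a : ℕ}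
    (h : ∀ i ∈ S, a ∣ sz i) : a ^ S.card ∣ ∏ i ∈ S, sz i := by
  rw [← Finset.prod_const]
  exact Finset.prod_dvd_prod_of_dvd _ _ h

theorem four_pow_card_dvd_two_mul_prod {ι : Type*} {sz : ι → ℕ} {S : Finset ι} {p : ℕ}
    (h2 : ∀ i, 2 ∣ sz i) (h4 : ∀ i, ¬ p ∣ sz i → 4 ∣ sz i)
    (hcard : (S.filter fun i => p ∣ sz i).card ≤ 1) : 4 ^ S.card ∣ 2 * ∏ i ∈ S, sz i := by
  rw [← Finset.prod_filter_mul_prod_filter_not S (fun i => p ∣ sz i),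
    ← Finset.card_filter_add_card_filter_not (s := S) (fun i => p ∣ sz i), pow_add, ← mul_assoc]
  refine mul_dvd_mul ?_ (pow_card_dvd_prod fun i hi => h4 i (Finset.mem_filter.1 hi).2)
  rw [show 4 = 2 * 2 from rfl, mul_pow]
  refine mul_dvd_mul ?_ (pow_card_dvd_prod fun i _ => h2 i)
  simpa using pow_dvd_pow 2 hcard

/-- A subset of prescribed size can be chosen so that `P` holds somewhere on both parts, or
nowhere on the subset and at most once on its complement. -/
theorem Finset.exists_subset_card_eq_splitting {ι : Type*} [DecidableEq ι] (P : ι → Prop)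
    [DecidablePred P] (S : Finset ι) {k : ℕ} (hk : 1 ≤ k) (hkS : k < S.card) :
    ∃ T ⊆ S, T.card = k ∧ (((∃ i ∈ T, P i) ∧ ∃ i ∈ S \ T, P i) ∨
      ((∀ i ∈ T, ¬ P i) ∧ ((S \ T).filter P).card ≤ 1)) := by
  rcases le_or_gt (S.filter P).card 1 with h | h
  · have hcard := Finset.card_filter_add_card_filter_not (s := S) P
    obtain ⟨T, hT, hTk⟩ := Finset.exists_subset_card_eq
      (show k ≤ (S.filter fun i => ¬ P i).card by omega)
    refine ⟨T, hT.trans (Finset.filter_subset _ _), hTk, Or.inr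
      ⟨fun i hi => (Finset.mem_filter.1 (hT hi)).2, ?_⟩⟩
    exact (Finset.card_le_card (Finset.filter_subset_filter _ Finset.sdiff_subset)).trans h
  · obtain ⟨i, hi, j, hj, hij⟩ := Finset.one_lt_card.1 h
    rw [Finset.mem_filter] at hi hj
    obtain ⟨T, hiT, hTS, hTk⟩ := Finset.exists_subsuperset_card_eq
      (s := {i}) (t := S.erase j) (n := k) (by simpa using ⟨hij, hi.1⟩) (by simpa using hk)
      (by rw [Finset.card_erase_of_mem hj.1]; omega)
    refine ⟨T, hTS.trans (Finset.erase_subset _ _), hTk, Or.inl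
      ⟨⟨i, hiT (Finset.mem_singleton_self i), hi.2⟩, j, ?_, hj.2⟩⟩
    exact Finset.mem_sdiff.2 ⟨hj.1, fun h => Finset.notMem_erase _ _ (hTS h)⟩

theorem not_dvd_or_not_dvd_add_two {p : ℕ} (hp : p.Prime) (hp2 : p ≠ 2) (c : ℕ) :
    ¬ p ∣ c ∨ ¬ p ∣ c + 2 := by
  by_contra! h
  exact hp2 ((Nat.prime_dvd_prime_iff_eq hp Nat.prime_two).1 ((Nat.dvd_add_right h.1).1 h.2))

theorem exists_isLongRunCycle {ι : Type*} [DecidableEq ι] {sz : ι → ℕ} {p : ℕ} (hp : p.Prime)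
    (hp2 : p ≠ 2) (hsz : ∀ i, 3 ≤ sz i)
    (hform : ∀ i, ∃ q r : ℕ, 1 ≤ q ∧ sz i = 2 ^ q * p ^ r) (n : ℕ) (hn : 1 ≤ n)
    (S : Finset ι) (hS : S.card = 2 * n) : ∃ f w, IsLongRunCycle sz S n f w := by
  have hp3 : 3 ≤ p := by have := hp.two_le; omega
  have h2 (i : ι) : 2 ∣ sz i := by
    obtain ⟨q, r, hq, hqr⟩ := hform i
    exact hqr ▸ (dvd_pow_self 2 (by omega)).mul_right _
  have h4 (i : ι) (hi : ¬ p ∣ sz i) : 4 ∣ sz i := by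
    obtain ⟨q, r, hq, hqr⟩ := hform i
    obtain rfl : r = 0 := by
      by_contra hr
      exact hi (hqr ▸ (dvd_pow_self p hr).mul_left _)
    have h3 := hsz i
    rw [hqr, pow_zero, mul_one] at h3 ⊢
    refine pow_dvd_pow 2 (show 2 ≤ q from ?_)
    by_contra! hq2
    obtain rfl : q = 1 := by omega
    norm_num at h3
  induction n using Nat.strong_induction_on generalizing S with
  | _ n ih =>
  rcases hn.eq_or_lt with rfl | hn
  · obtain ⟨a, b, hab, rfl⟩ := Finset.card_eq_two.1 hS
    exact exists_isLongRunCycle_pair sz hab (h2 a) (h2 b) (by have := hsz a; omega)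
  obtain ⟨l, n₂, rfl, hn₂⟩ : ∃ l n₂, n = (l + 1) + n₂ ∧ (n₂ = l + 1 ∨ n₂ = l + 1 + 1) :=
    ⟨n / 2 - 1, n - n / 2, by omega, by omega⟩
  obtain ⟨S₁, hS₁, hc₁, hP⟩ := S.exists_subset_card_eq_splitting (fun i => p ∣ sz i)
    (k := 2 * (l + 1)) (by omega) (by omega)
  obtain ⟨S₂, hS₂⟩ : ∃ S₂, S₂ = S \ S₁ := ⟨_, rfl⟩
  have hc₂ : S₂.card = 2 * n₂ := by
    rw [hS₂, Finset.card_sdiff_of_subset hS₁]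
    omega
  rw [← hS₂] at hP
  have hdisj : Disjoint S₁ S₂ := hS₂ ▸ Finset.disjoint_sdiff
  have hun : S = S₁ ∪ S₂ := by rw [hS₂, Finset.union_sdiff_of_subset hS₁]
  obtain ⟨f₁, w₁, h₁⟩ := ih (l + 1) (by omega) (by omega) S₁ hc₁
  obtain ⟨f₂, w₂, h₂⟩ := ih n₂ (by omega) (by omega) S₂ hc₂
  rw [hun]
  obtain ⟨d, hd⟩ : ∃ d, d = Nat.gcd (∏ i ∈ S₁, sz i) (∏ i ∈ S₂, sz i) := ⟨_, rfl⟩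
  have hd0 : 0 < d := by
    rw [hd]
    exact Nat.gcd_pos_of_pos_left _ (Finset.prod_pos fun i _ => by have := hsz i; omega)
  rcases hP with ⟨⟨i, hi, hpi⟩, j, hj, hpj⟩ | ⟨hP₁, hP₂⟩
  · have hpd : p ∣ d := hd ▸ Nat.dvd_gcd (hpi.trans (Finset.dvd_prod_of_mem sz hi))
      (hpj.trans (Finset.dvd_prod_of_mem sz hj))
    have h4d : 2 ^ (2 * (l + 1)) ∣ d := by
      rw [hd]
      refine Nat.dvd_gcd (hc₁ ▸ pow_card_dvd_prod fun i _ => h2 i) ?_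
      refine (pow_dvd_pow 2 ?_).trans (pow_card_dvd_prod fun i _ => h2 i)
      omega
    have hcop : Nat.Coprime 2 p := (Nat.coprime_primes Nat.prime_two hp).2 (Ne.symm hp2)
    have hle := Nat.le_of_dvd hd0 ((hcop.pow_left _).mul_dvd_of_dvd_of_dvd h4d hpd)
    have hb : l + 1 ≤ 4 ^ l := Nat.lt_pow_self (by norm_num)
    rw [pow_mul, pow_succ] at hle
    have hle' := (Nat.mul_le_mul_left ((2 ^ 2) ^ l * 2 ^ 2) hp3).trans hle
    norm_num at hle'
    obtain ⟨e, rfl⟩ : 4 ∣ d := (pow_dvd_pow 2 (show 2 ≤ 2 * (l + 1) by omega)).trans h4d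
    have hpe : p ∣ 2 * e := by
      refine hcop.symm.dvd_of_dvd_mul_left (k := p) (m := 2) ?_
      rwa [← mul_assoc]
    have hnd₂ : ¬ p ∣ 2 * e + 1 := fun h => hp.one_lt.ne'
      (Nat.dvd_one.1 ((Nat.dvd_add_right hpe).1 h))
    have hnd₁ : ¬ p ∣ 2 * e - 1 := fun h => hp.one_lt.ne' (Nat.dvd_one.1
      ((Nat.dvd_add_right h).1 (by rwa [Nat.sub_add_cancel (show 1 ≤ 2 * e by omega)])))
    have hsum : 2 * e - 1 + (2 * e + 1) = 4 * e := by omega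
    refine h₁.exists_union h₂ hdisj (d₁ := 2 * e - 1) (d₂ := 2 * e + 1) (by omega)
      (by rw [hsum, hd])
      (coprime_prod_of_two_pow_mul_prime_pow hp hform (by omega) (Or.inl hnd₁))
      (coprime_prod_of_two_pow_mul_prime_pow hp hform (by omega) (Or.inl hnd₂)) ?_ ?_
    · rw [hsum]
      zify [show 1 ≤ 2 * e by omega]
      rcases hn₂ with rfl | rfl <;> push_cast <;> nlinarith
    · rw [hsum]
      rcases hn₂ with rfl | rfl <;> nlinarith
  · have h16₁ : 16 ^ (l + 1) ∣ ∏ i ∈ S₁, sz i := by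
      rw [show 16 = 4 ^ 2 from rfl, ← pow_mul, ← hc₁]
      exact pow_card_dvd_prod fun i hi => h4 i (hP₁ i hi)
    have h16₂ : 16 ^ n₂ ∣ 2 * ∏ i ∈ S₂, sz i := by
      rw [show 16 = 4 ^ 2 from rfl, ← pow_mul, ← hc₂]
      exact four_pow_card_dvd_two_mul_prod h2 h4 hP₂
    have hb : 1 + l * 15 ≤ 16 ^ l := by
      clear * -
      induction l with
      | zero => norm_num
      | succ l ih => rw [pow_succ]; omega
    have finish : ∀ d₁ d₂ : ℕ, d₁ + d₂ = d → ¬ 2 ∣ d₁ → ¬ 2 ∣ d₂ → ¬ p ∣ d₂ →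
        (l + 1 + n₂ + 1) * d₁ ≤ (l + 1 + 1) * d → (l + 1 + n₂ + 1) * d₂ ≤ (n₂ + 1) * d →
        ∃ f w, IsLongRunCycle sz (S₁ ∪ S₂) (l + 1 + n₂) f w := by
      intro d₁ d₂ hsum ho₁ ho₂ hp₂ hw₁ hw₂
      refine h₁.exists_union h₂ hdisj (by omega) (by rw [hsum, hd])
        (coprime_prod_of_two_pow_mul_prime_pow hp hform ho₁ (Or.inr hP₁))
        (coprime_prod_of_two_pow_mul_prime_pow hp hform ho₂ (Or.inl hp₂)) ?_ ?_ <;> rwa [hsum]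
    rcases hn₂ with rfl | rfl
    · have h8 : 8 * 16 ^ l ∣ d := by
        rw [hd]
        refine Nat.dvd_gcd (dvd_trans ⟨2, by ring⟩ h16₁) ?_
        refine Nat.dvd_of_mul_dvd_mul_left two_pos (dvd_trans (dvd_of_eq ?_) h16₂)
        ring
      have hle := Nat.le_of_dvd hd0 h8
      obtain ⟨e, rfl⟩ : 4 ∣ d := (Dvd.intro (2 * 16 ^ l) (by ring)).trans h8
      rcases not_dvd_or_not_dvd_add_two hp hp2 (2 * e - 1) with h | h
      · refine finish (2 * e + 1) (2 * e - 1) (by omega) (by omega) (by omega) h ?_ ?_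
        · nlinarith
        · zify [show 1 ≤ 2 * e by omega]
          nlinarith
      · rw [show 2 * e - 1 + 2 = 2 * e + 1 by omega] at h
        refine finish (2 * e - 1) (2 * e + 1) (by omega) (by omega) (by omega) h ?_ ?_
        · zify [show 1 ≤ 2 * e by omega]
          nlinarith
        · nlinarith
    · have h16 : 16 * 16 ^ l ∣ d := by
        rw [hd]
        refine Nat.dvd_gcd (dvd_trans ⟨1, by ring⟩ h16₁) ?_
        refine Nat.dvd_of_mul_dvd_mul_left two_pos (dvd_trans ⟨8, ?_⟩ h16₂)
        ring
      have hle := Nat.le_of_dvd hd0 h16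
      obtain ⟨e, rfl⟩ : 4 ∣ d := (Dvd.intro (4 * 16 ^ l) (by ring)).trans h16
      rcases not_dvd_or_not_dvd_add_two hp hp2 (2 * e + 1) with h | h
      · refine finish (2 * e - 1) (2 * e + 1) (by omega) (by omega) (by omega) h ?_ ?_
        · zify [show 1 ≤ 2 * e by omega]
          nlinarith
        · nlinarith
      · refine finish (2 * e - 3) (2 * e + 3) (by omega) (by omega) (by omega) h ?_ ?_
        · zify [show 3 ≤ 2 * e by omega]
          nlinarith
        · nlinarith

theorem le_torusCard_of_windowOk {k : ℕ} {sz : Fin k → ℕ} (hsz : ∀ i, 2 ≤ sz i)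
    {f : ZMod (torusCard k sz) → TorusVtx k sz} (hf : IsHamCycle f) {r : ℕ} (hr : WindowOk f r) :
    r ≤ torusCard k sz := by
  by_contra! hlt
  have hpos : 0 < torusCard k sz := Finset.prod_pos fun i _ => by have := hsz i; omega
  obtain ⟨i, hi, -⟩ := hf.2 0
  have : Fact (1 < sz i) := ⟨hsz i⟩
  have hedge : EdgeInDim f i 0 := by
    intro h
    rcases hi with hi | hi <;> simp [h] at hi
  exact hr 0 i 0 (torusCard k sz) (by omega) hlt hpos.ne (by simpa using hedge)

theorem le_mrl {k : ℕ} {sz : Fin k → ℕ} (hsz : ∀ i, 2 ≤ sz i)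
    {f : ZMod (torusCard k sz) → TorusVtx k sz} (hf : IsHamCycle f) {r : ℕ} (hr1 : 1 ≤ r)
    (hr : WindowOk f r) : r ≤ mrl k sz := by
  have h1 : r ≤ runLength f :=
    le_csSup ⟨torusCard k sz, fun _ h => le_torusCard_of_windowOk hsz hf h.2⟩ ⟨hr1, hr⟩
  refine h1.trans (le_csSup ⟨torusCard k sz, ?_⟩ ⟨f, hf, rfl⟩)
  rintro _ ⟨g, hg, rfl⟩
  exact csSup_le' fun _ h => le_torusCard_of_windowOk hsz hg h.2

theorem IsLongRunCycle.le_mrl {k : ℕ} {sz : Fin k → ℕ} (hsz : ∀ i, 2 ≤ sz i) {n : ℕ}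
    {f : ℤ → Fin k → ℤ} {w : ℤ → Fin k} (h : IsLongRunCycle sz Finset.univ n f w) :
    n + 1 ≤ mrl k sz := by
  have hpos : 0 < torusCard k sz := Finset.prod_pos fun i _ => by have := hsz i; omega
  have : NeZero (torusCard k sz) := ⟨hpos.ne'⟩
  have (i : Fin k) : Fact (1 < sz i) := ⟨hsz i⟩
  have (i : Fin k) : NeZero (sz i) := ⟨by have := hsz i; omega⟩
  let v (t : ℤ) : TorusVtx k sz := fun i => (f t i : ZMod (sz i))
  have hv (s t : ℤ) : v s = v t ↔ (s : ZMod (torusCard k sz)) = t := by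
    rw [ZMod.intCast_eq_intCast_iff, torusCard, ← h.modEq_iff]
    simp only [Finset.mem_univ, forall_true_left, ← ZMod.intCast_eq_intCast_iff]
    exact funext_iff
  obtain ⟨F, hF⟩ : ∃ F : ZMod (torusCard k sz) → TorusVtx k sz, ∀ t : ℤ, F t = v t :=
    ⟨fun z => v z.val, fun t => (hv _ _).2 (by simp)⟩
  have hF1 (t : ℤ) : F ((t : ZMod (torusCard k sz)) + 1) = v (t + 1) := by
    rw [← hF]
    push_cast
    rfl
  have hedge (t : ℤ) (i : Fin k) (hi : EdgeInDim F i t) : i = w t := by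
    by_contra hne
    refine hi ?_
    rw [hF, hF1]
    exact congrArg _ (h.stay t i hne).symm
  have hinj : Function.Injective F := by
    intro x y hxy
    obtain ⟨s, rfl⟩ := ZMod.intCast_surjective x
    obtain ⟨t, rfl⟩ := ZMod.intCast_surjective y
    rwa [hF, hF, hv] at hxy
  have : Fintype (TorusVtx k sz) := inferInstanceAs (Fintype (∀ i, ZMod (sz i)))
  have hcard : Fintype.card (ZMod (torusCard k sz)) = Fintype.card (TorusVtx k sz) := by
    rw [ZMod.card, ← Nat.card_eq_fintype_card, TorusVtx, Nat.card_pi]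
    simp [torusCard]
  refine _root_.le_mrl hsz (f := F) ⟨(Fintype.bijective_iff_injective_and_card F).2 ⟨hinj, hcard⟩,
    fun x => ?_⟩ (by omega) ?_
  · obtain ⟨t, rfl⟩ := ZMod.intCast_surjective x
    rw [hF, hF1]
    refine ⟨w t, ?_, fun j hj => congrArg _ (h.stay t j hj).symm⟩
    refine (h.step t).imp (fun e => ?_) fun e => ?_
    all_goals simp only [v, e]; push_cast; rfl
  · intro x i a b ha hb hab ⟨h1, h2⟩
    obtain ⟨t, rfl⟩ := ZMod.intCast_surjective x
    have e1 := hedge (t + a) i (by simpa using h1)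
    have e2 := hedge (t + b) i (by simpa using h2)
    rcases hab.lt_or_gt with hlt | hlt
    · refine h.window (t + a) (b - a) (by omega) (by omega) ?_
      rw [← e1, e2]
      congr 1
      ring
    · refine h.window (t + b) (a - b) (by omega) (by omega) ?_
      rw [← e2, e1]
      congr 1
      ring

/-- **Application 3.**  Let `p` be a prime, `n ≥ 1`, and let
`G = γ₁ × ⋯ × γ_{2n}` be a torus with `2n` dimensions such that each `γ_i` has
`2^{q_i} · p^{r_i}` vertices for some integers `q_i ≥ 1` and `r_i ≥ 0`.
Then `mrl(G) ≥ n + 1`. -/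
theorem mrl_two_pow_prime_power_two_n
    (p : ℕ) (hp : p.Prime) (n : ℕ) (hn : 1 ≤ n)
    (sz : Fin (2 * n) → ℕ) (hsz : ∀ i, 3 ≤ sz i)
    (hform : ∀ i, ∃ q r : ℕ, 1 ≤ q ∧ sz i = 2 ^ q * p ^ r) :
    n + 1 ≤ mrl (2 * n) sz := by
  have key : ∃ p' : ℕ, p'.Prime ∧ p' ≠ 2 ∧
      ∀ i, ∃ q r : ℕ, 1 ≤ q ∧ sz i = 2 ^ q * p' ^ r := by
    by_cases hp2 : p = 2
    · refine ⟨3, Nat.prime_three, by norm_num, fun i => ?_⟩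
      obtain ⟨q, r, hq, hqr⟩ := hform i
      exact ⟨q + r, 0, by omega, by rw [hqr, hp2]; ring⟩
    · exact ⟨p, hp, hp2, hform⟩
  obtain ⟨p', hp', hp2, hform'⟩ := key
  obtain ⟨f, w, h⟩ := exists_isLongRunCycle hp' hp2 hsz hform' n hn Finset.univ (by simp)
  exact h.le_mrl fun i => by have := hsz i; omega
end

section
/- Let G = γ₁ × γ₂ × ⋯ × γ_k be a torus admitting a Hamiltonian cycle, suppose |G| is even (i.e., some dimension has an even number of vertices), and let γ_{k+1} be any cycle graph. Then the (k+1)-dimensional torus G × γ_{k+1} admits a Hamiltonian cycle and mrl(G × γ_{k+1}) ≥ mrl(G). -/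
/-- Reflection of the torus in direction `d`, exchanging the `d`-coordinates of `u` and `v`. -/
def torusReflect {k : ℕ} {sz : Fin k → ℕ} (u v : TorusVtx k sz) (d : Fin k)
    (x : TorusVtx k sz) : TorusVtx k sz :=
  fun i => if i = d then u i + v i - x i else x i

lemma torusReflect_involutive {k : ℕ} {sz : Fin k → ℕ} (u v : TorusVtx k sz) (d : Fin k) :
    Function.Involutive (torusReflect u v d) := by
  intro x
  funext i
  by_cases h : i = d <;> simp [torusReflect, h]

lemma torusReflect_left {k : ℕ} {sz : Fin k → ℕ} {u v : TorusVtx k sz} {d : Fin k}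
    (h : ∀ j, j ≠ d → u j = v j) : torusReflect u v d u = v := by
  funext i
  by_cases hi : i = d
  · simp [torusReflect, hi]
  · simp [torusReflect, hi, h i hi]

lemma torusReflect_apply_ne_iff {k : ℕ} {sz : Fin k → ℕ} (u v : TorusVtx k sz) (d : Fin k)
    (x y : TorusVtx k sz) (i : Fin k) :
    torusReflect u v d x i ≠ torusReflect u v d y i ↔ x i ≠ y i := by
  by_cases h : i = d <;> simp [torusReflect, h]

lemma TorusAdj.torusReflect {k : ℕ} {sz : Fin k → ℕ} (u v : TorusVtx k sz) (d : Fin k)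
    {x y : TorusVtx k sz} (h : TorusAdj x y) :
    TorusAdj (torusReflect u v d x) (torusReflect u v d y) := by
  obtain ⟨i, hi, hne⟩ := h
  refine ⟨i, ?_, fun j hj => ?_⟩
  · by_cases hd : i = d
    · simp only [_root_.torusReflect, hd, if_true]
      subst hd
      rcases hi with hi | hi
      · right; rw [hi]; ring
      · left; rw [hi]; ring
    · simpa [_root_.torusReflect, hd] using hi
  · by_contra hc
    exact (torusReflect_apply_ne_iff u v d x y j).1 hc (hne j hj)

/-- `g` is an injective closed walk in the torus whose edges have the same dimensions as those
of `f`. -/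
def SameDims {k : ℕ} {sz : Fin k → ℕ} (f g : ZMod (torusCard k sz) → TorusVtx k sz) : Prop :=
  Function.Injective g ∧ (∀ t, TorusAdj (g t) (g (t + 1))) ∧
    ∀ i t, EdgeInDim g i t ↔ EdgeInDim f i t

lemma SameDims.exists_swap {k : ℕ} {sz : Fin k → ℕ}
    {f g : ZMod (torusCard k sz) → TorusVtx k sz} (hg : SameDims f g)
    (p : ZMod (torusCard k sz)) :
    ∃ g', SameDims f g' ∧ g' (p + 1) = g p ∧ g' p = g (p + 1) := by
  obtain ⟨hinj, hadj, hdim⟩ := hg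
  obtain ⟨d, -, hd⟩ := hadj p
  have hinv := torusReflect_involutive (g p) (g (p + 1)) d
  have hl := torusReflect_left hd
  refine ⟨fun t => torusReflect (g p) (g (p + 1)) d (g t),
    ⟨hinv.injective.comp hinj, fun t => (hadj t).torusReflect _ _ _, fun i t => ?_⟩, ?_, hl⟩
  · rw [← hdim]
    exact torusReflect_apply_ne_iff _ _ _ _ _ _
  · have := hinv (g p)
    rwa [hl] at this

/-- A closed walk in each layer such that consecutive layers are exchanged at prescribed
positions. -/
lemma exists_layers {k : ℕ} {sz : Fin k → ℕ} {f : ZMod (torusCard k sz) → TorusVtx k sz}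
    (hf : IsHamCycle f) (p : ℕ → ZMod (torusCard k sz)) :
    ∃ g : ℕ → ZMod (torusCard k sz) → TorusVtx k sz, (∀ n, SameDims f (g n)) ∧
      ∀ n, g (n + 1) (p n + 1) = g n (p n) ∧ g (n + 1) (p n) = g n (p n + 1) := by
  choose next hnext hswap using
    fun (n : ℕ) (g : {g // SameDims f g}) => g.2.exists_swap (p n)
  let G : ℕ → {g // SameDims f g} := fun n =>
    Nat.rec ⟨f, hf.1.injective, hf.2, fun _ _ => Iff.rfl⟩
      (fun n g => ⟨next n g, hnext n g⟩) n
  exact ⟨fun n => (G n).1, fun n => (G n).2, fun n => hswap n (G n)⟩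

/-- The layer visited in block `c`, when layers `0, …, m - 1` are visited upwards and then
downwards. -/
def snakeLayer (m c : ℕ) : ℕ := if c < m then c else 2 * m - 1 - c

lemma snakeLayer_lt {m c : ℕ} (hc : c < 2 * m) : snakeLayer m c < m := by
  unfold snakeLayer; split_ifs <;> omega

lemma snakeLayer_eq {m c c' : ℕ} (hc : c < 2 * m) (hc' : c' < 2 * m)
    (h : snakeLayer m c = snakeLayer m c') (hpar : c % 2 = c' % 2) : c = c' := by
  unfold snakeLayer at h; split_ifs at h <;> omega

/-- One step of the time `τ`, in blocks of length `h`, either keeps the layer or moves between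
layers `c` and `c + 1` at a time congruent to `h * (c + 1)` modulo `2 * h`. -/
lemma snakeLayer_step {m h τ : ℕ} (hh : 0 < h) (hτ : τ < 2 * h * m) :
    snakeLayer m ((τ + 1) % (2 * h * m) / h) = snakeLayer m (τ / h) ∨
      ∃ c, τ + 1 ≡ h * (c + 1) [MOD 2 * h] ∧
        (snakeLayer m (τ / h) = c ∧ snakeLayer m ((τ + 1) % (2 * h * m) / h) = c + 1 ∨
          snakeLayer m (τ / h) = c + 1 ∧ snakeLayer m ((τ + 1) % (2 * h * m) / h) = c) := by
  have hq : τ / h < 2 * m := by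
    rw [Nat.div_lt_iff_lt_mul hh]; linarith
  by_cases hd : h ∣ τ + 1
  · obtain ⟨b, hb⟩ := hd
    have hb1 : τ / h + 1 = b := by
      rw [← Nat.succ_div_of_dvd ⟨b, hb⟩, hb, Nat.mul_div_cancel_left _ hh]
    generalize τ / h = q at *
    subst hb1
    rcases Nat.lt_or_ge (q + 1) (2 * m) with hlt | hge
    · have hlt' : τ + 1 < 2 * h * m := by
        rw [hb]; nlinarith
      rw [Nat.mod_eq_of_lt hlt', hb, Nat.mul_div_cancel_left _ hh]
      rcases lt_trichotomy (q + 1) m with h1 | h1 | h1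
      · refine Or.inr ⟨q, rfl, Or.inl ?_⟩
        unfold snakeLayer; split_ifs <;> omega
      · left
        unfold snakeLayer; split_ifs <;> omega
      · refine Or.inr ⟨2 * m - 2 - q, ?_, Or.inr ?_⟩
        · have : q + 1 = (2 * m - 2 - q + 1) + 2 * (q + 1 - m) := by omega
          rw [this, mul_add, ← mul_assoc, mul_comm h 2]
          simp [Nat.ModEq]
        · unfold snakeLayer; split_ifs <;> omega
    · left
      have : q + 1 = 2 * m := by omega
      have hM : τ + 1 = 2 * h * m := by rw [hb, this]; ring
      rw [hM, Nat.mod_self, Nat.zero_div]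
      unfold snakeLayer; split_ifs <;> omega
  · left
    have hlt : τ + 1 < 2 * h * m := by
      rcases Nat.lt_or_ge (τ + 1) (2 * h * m) with h1 | h1
      · exact h1
      · exact absurd ⟨2 * m, by nlinarith⟩ hd
    rw [Nat.mod_eq_of_lt hlt, Nat.succ_div_of_not_dvd hd]

lemma torusCard_succ {k : ℕ} (sz : Fin (k + 1) → ℕ) :
    torusCard (k + 1) sz = torusCard k (fun i => sz i.castSucc) * sz (Fin.last k) :=
  Fin.prod_univ_castSucc _

lemma card_torusVtx {k : ℕ} (sz : Fin k → ℕ) :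
    Nat.card (TorusVtx k sz) = torusCard k sz := by
  unfold TorusVtx torusCard
  simp [Nat.card_pi]

lemma exists_edgeInDim {k : ℕ} {sz : Fin k → ℕ} (hsz : ∀ i, 3 ≤ sz i)
    {f : ZMod (torusCard k sz) → TorusVtx k sz} (hf : IsHamCycle f)
    (t : ZMod (torusCard k sz)) : ∃ i, EdgeInDim f i t := by
  obtain ⟨i, hi, -⟩ := hf.2 t
  have : Fact (1 < sz i) := ⟨by have := hsz i; omega⟩
  refine ⟨i, fun h => ?_⟩
  rw [h] at hi
  simp at hi

lemma WindowOk.le {k : ℕ} {sz : Fin k → ℕ} (hsz : ∀ i, 3 ≤ sz i)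
    {f : ZMod (torusCard k sz) → TorusVtx k sz} (hf : IsHamCycle f) {r : ℕ}
    (hr : WindowOk f r) : r ≤ k := by
  choose d hd using exists_edgeInDim hsz hf
  have hinj : Function.Injective fun a : Fin r => d (0 + ((a : ℕ) : ZMod (torusCard k sz))) := by
    intro a b hab
    by_contra hne
    refine hr 0 _ a b a.2 b.2 (fun h => hne (Fin.ext h)) ⟨hd _, ?_⟩
    have hab' : d (0 + ((a : ℕ) : ZMod (torusCard k sz)))
      = d (0 + ((b : ℕ) : ZMod (torusCard k sz))) := hab
    rw [hab']
    exact hd _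
  simpa using Fintype.card_le_of_injective _ hinj

lemma bddAbove_windowOk {k : ℕ} {sz : Fin k → ℕ} (hsz : ∀ i, 3 ≤ sz i)
    {f : ZMod (torusCard k sz) → TorusVtx k sz} (hf : IsHamCycle f) :
    BddAbove {r : ℕ | 1 ≤ r ∧ WindowOk f r} :=
  ⟨k, fun _ hr => WindowOk.le hsz hf hr.2⟩

lemma runLength_mem {k : ℕ} {sz : Fin k → ℕ} (hsz : ∀ i, 3 ≤ sz i)
    {f : ZMod (torusCard k sz) → TorusVtx k sz} (hf : IsHamCycle f) :
    1 ≤ runLength f ∧ WindowOk f (runLength f) :=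
  Nat.sSup_mem (s := {r : ℕ | 1 ≤ r ∧ WindowOk f r})
    ⟨1, le_rfl, fun _ _ a b ha hb hab => by omega⟩ (bddAbove_windowOk hsz hf)

lemma bddAbove_runLength {k : ℕ} {sz : Fin k → ℕ} (hsz : ∀ i, 3 ≤ sz i) :
    BddAbove {m : ℕ | ∃ f, IsHamCycle (k := k) (sz := sz) f ∧ m = runLength f} := by
  refine ⟨k, ?_⟩
  rintro _ ⟨f, hf, rfl⟩
  exact WindowOk.le hsz hf (runLength_mem hsz hf).2

lemma two_mul_lt_torusCard {k : ℕ} {sz : Fin k → ℕ} (hsz : ∀ i, 3 ≤ sz i) :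
    2 * k < torusCard k sz := by
  have h1 : 3 ^ k ≤ torusCard k sz := by
    simpa [torusCard] using Finset.pow_card_le_prod Finset.univ sz 3 fun i _ => hsz i
  have h2 : 1 + k * 2 ≤ (1 + 2) ^ k := by
    have := one_add_mul_le_pow (show (-2 : ℤ) ≤ 2 by norm_num) k
    exact_mod_cast this
  norm_num at h2
  omega

/-- Lifting a Hamiltonian cycle through one extra dimension, preserving all run-length windows. -/
lemma exists_isHamCycle_succ {k : ℕ} (sz : Fin (k + 1) → ℕ) (hsz : ∀ i, 3 ≤ sz i)
    (heven : Even (torusCard k fun i => sz i.castSucc))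
    {f : ZMod (torusCard k fun i => sz i.castSucc) → TorusVtx k fun i => sz i.castSucc}
    (hf : IsHamCycle f) :
    ∃ F, IsHamCycle (k := k + 1) (sz := sz) F ∧ ∀ r, WindowOk f r → WindowOk F r := by
  let N := torusCard k fun i => sz i.castSucc
  have hN : N = torusCard k fun i => sz i.castSucc := rfl
  set m := sz (Fin.last k) with hm
  have hkN : 2 * k < N := two_mul_lt_torusCard fun i => hsz i.castSucc
  obtain ⟨h, hh2⟩ : ∃ h, N = h + h := heven
  have hh : 0 < h := by omega
  have hm3 : 3 ≤ m := hsz _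
  have hM : torusCard (k + 1) sz = 2 * h * m := by
    rw [torusCard_succ, ← hN, hh2]; ring
  have hNM : N ∣ torusCard (k + 1) sz := ⟨m, torusCard_succ sz⟩
  have hM0 : 0 < 2 * h * m := by positivity
  have : NeZero (torusCard (k + 1) sz) := ⟨by omega⟩
  obtain ⟨g, hg, hswap⟩ := exists_layers hf fun n => ((h * (n + 1) : ℕ) : ZMod N) - 1
  simp only [sub_add_cancel] at hswap
  let L : ZMod (torusCard (k + 1) sz) → ℕ := fun t => snakeLayer m (t.val / h)
  let P : ZMod (torusCard (k + 1) sz) →+* ZMod N := ZMod.castHom hNM _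
  have hPval : ∀ t, P t = (t.val : ZMod N) := fun t => by
    conv_lhs => rw [← ZMod.natCast_zmod_val t]
    exact map_natCast P _
  have hval : ∀ t : ZMod (torusCard (k + 1) sz), t.val < 2 * h * m := fun t =>
    hM ▸ ZMod.val_lt t
  have hblock : ∀ t : ZMod (torusCard (k + 1) sz), t.val / h < 2 * m := fun t => by
    rw [Nat.div_lt_iff_lt_mul hh]; linarith [hval t]
  have hstep : ∀ t, L (t + 1) = L t ∨ (h ∣ t.val + 1 ∧ g (L (t + 1)) (P (t + 1)) = g (L t) (P t) ∧
      (L (t + 1) = L t + 1 ∨ L t = L (t + 1) + 1)) := by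
    intro t
    have hv : (t + 1).val = (t.val + 1) % (2 * h * m) := by
      rw [ZMod.val_add, ZMod.val_one'' (by nlinarith), ← hM]
    have hLt : L (t + 1) = snakeLayer m ((t.val + 1) % (2 * h * m) / h) := by rw [← hv]
    rcases snakeLayer_step hh (hval t) with h1 | ⟨c, hc, h1⟩
    · left; rw [hLt, h1]
    · right
      have hP : P t + 1 = ((h * (c + 1) : ℕ) : ZMod N) := by
        rw [hPval, ← Nat.cast_add_one, ZMod.natCast_eq_natCast_iff, hh2, ← two_mul]
        exact hc
      have hP' : P t = ((h * (c + 1) : ℕ) : ZMod N) - 1 := by rw [← hP]; ring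
      refine ⟨(hc.dvd_iff (Dvd.intro_left 2 rfl)).2 (Dvd.intro _ rfl), ?_⟩
      rw [map_add, map_one, hP, hP', hLt]
      change g _ _ = g (snakeLayer m (t.val / h)) _ ∧
        (_ = snakeLayer m (t.val / h) + 1 ∨ snakeLayer m (t.val / h) = _)
      rcases h1 with ⟨h1, h2⟩ | ⟨h1, h2⟩
      · rw [h1, h2]
        exact ⟨(hswap c).1, Or.inl rfl⟩
      · rw [h1, h2]
        exact ⟨(hswap c).2.symm, Or.inr rfl⟩
  let F : ZMod (torusCard (k + 1) sz) → TorusVtx (k + 1) sz := fun t =>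
    Fin.snoc (α := fun i => ZMod (sz i)) (g (L t) (P t)) (L t : ZMod m)
  have hFc : ∀ t (i : Fin k), F t i.castSucc = g (L t) (P t) i := fun t i =>
    Fin.snoc_castSucc (α := fun i => ZMod (sz i)) _ _ _
  have hFl : ∀ t, F t (Fin.last k) = (L t : ZMod m) := fun t =>
    Fin.snoc_last (α := fun i => ZMod (sz i)) _ _
  have hinj : Function.Injective F := by
    intro s t hst
    have hL : L s = L t := by
      have h1 := congrFun hst (Fin.last k)
      rw [hFl, hFl, ZMod.natCast_eq_natCast_iff] at h1
      exact h1.eq_of_lt_of_lt (snakeLayer_lt (hblock s)) (snakeLayer_lt (hblock t))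
    have hP : P s = P t := by
      apply (hg (L t)).1
      funext i
      have h1 := congrFun hst i.castSucc
      rwa [hFc, hFc, hL] at h1
    rw [hPval, hPval, ZMod.natCast_eq_natCast_iff, hh2] at hP
    have hmod : ∀ n : ℕ, n / h % 2 = n % (h + h) / h := fun n => by
      rw [← mul_two, Nat.mod_mul_right_div_self]
    have hdiv : s.val / h = t.val / h :=
      snakeLayer_eq (hblock s) (hblock t) hL (by rw [hmod, hmod, hP])
    have hmod' : s.val % h = t.val % h := Nat.ModEq.of_dvd ⟨2, by ring⟩ hP
    apply ZMod.val_injective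
    rw [← Nat.div_add_mod s.val h, ← Nat.div_add_mod t.val h, hdiv, hmod']
  have hcast : ∀ (i : Fin k) t, EdgeInDim F i.castSucc t → EdgeInDim f i (P t) := by
    intro i t he
    rw [EdgeInDim, hFc, hFc] at he
    rcases hstep t with h1 | ⟨-, h1, -⟩
    · rw [h1, map_add, map_one] at he
      exact ((hg _).2.2 i (P t)).1 he
    · exact absurd (congrFun h1.symm i) he
  have hlast : ∀ t, EdgeInDim F (Fin.last k) t → h ∣ t.val + 1 := by
    intro t he
    rw [EdgeInDim, hFl, hFl] at he
    rcases hstep t with h1 | ⟨h1, -⟩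
    · rw [h1] at he
      exact absurd rfl he
    · exact h1
  refine ⟨F, ⟨?_, fun t => ?_⟩, fun r hr t i a b ha hb hab => ?_⟩
  · have : ∀ i, NeZero (sz i) := fun i => ⟨by have := hsz i; omega⟩
    have : Finite (TorusVtx (k + 1) sz) := inferInstanceAs (Finite (∀ i, ZMod (sz i)))
    exact (Nat.bijective_iff_injective_and_card F).2
      ⟨hinj, by rw [card_torusVtx, Nat.card_zmod]⟩
  · rcases hstep t with h1 | ⟨-, h1, h2⟩
    · obtain ⟨i, hi, hne⟩ := (hg (L t)).2.1 (P t)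
      refine ⟨i.castSucc, ?_, fun j => Fin.lastCases (fun _ => ?_) (fun j hj => ?_) j⟩
      · rw [hFc, hFc, h1, map_add, map_one]
        exact hi
      · rw [hFl, hFl, h1]
      · rw [hFc, hFc, h1, map_add, map_one]
        exact hne j fun h => hj (by rw [h])
    · refine ⟨Fin.last k, ?_, fun j => Fin.lastCases (fun hj => absurd rfl hj) (fun j _ => ?_) j⟩
      · rw [hFl, hFl]
        exact h2.imp (fun h => by rw [h, Nat.cast_add_one]) (fun h => by rw [h, Nat.cast_add_one])
      · rw [hFc, hFc, h1]
  · rintro ⟨hea, heb⟩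
    induction i using Fin.lastCases with
    | cast i =>
      have h1 := hcast i _ hea
      have h2 := hcast i _ heb
      rw [map_add, map_natCast] at h1 h2
      exact hr (P t) i a b ha hb hab ⟨h1, h2⟩
    | last =>
      have hrk : r ≤ k := WindowOk.le (fun i => hsz i.castSucc) hf hr
      have hhM : h ∣ torusCard (k + 1) sz := ⟨2 * m, by rw [hM]; ring⟩
      have key : ∀ c : ℕ, h ∣ (t + (c : ZMod (torusCard (k + 1) sz))).val + 1 →
          t.val + c + 1 ≡ 0 [MOD h] := by
        intro c hc
        have h1 : (t + (c : ZMod (torusCard (k + 1) sz))).val ≡ t.val + c [MOD h] := by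
          refine Nat.ModEq.of_dvd hhM ?_
          rw [← ZMod.natCast_eq_natCast_iff]
          simp
        exact (h1.symm.add_right 1).trans ((Nat.modEq_zero_iff_dvd).2 hc)
      have hab' : a ≡ b [MOD h] := by
        have := (key a (hlast _ hea)).trans (key b (hlast _ heb)).symm
        exact Nat.ModEq.add_left_cancel' _ (Nat.ModEq.add_right_cancel' 1 this)
      exact hab (hab'.eq_of_lt_of_lt (by omega) (by omega))

/-- **Theorem 2 (adding an extra dimension, even case).**  Let
`G = γ₁ × ⋯ × γ_k` be a torus admitting a Hamiltonian cycle with `|G|` even,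
and let `γ_{k+1}` be any cycle graph (on `m ≥ 3` vertices).  Then the
`(k+1)`-dimensional torus `G × γ_{k+1}` admits a Hamiltonian cycle and
`mrl(G × γ_{k+1}) ≥ mrl(G)`. -/
theorem mrl_extra_dimension_of_even
    (k : ℕ) (sz : Fin k → ℕ) (hsz : ∀ i, 3 ≤ sz i)
    (hG : ∃ f, IsHamCycle (k := k) (sz := sz) f)
    (heven : Even (torusCard k sz))
    (m : ℕ) (hm : 3 ≤ m) :
    (∃ f, IsHamCycle (k := k + 1) (sz := Fin.snoc sz m) f) ∧
      mrl k sz ≤ mrl (k + 1) (Fin.snoc sz m) := by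
  have hsz' : ∀ i, 3 ≤ (Fin.snoc sz m : Fin (k + 1) → ℕ) i := fun i => by
    induction i using Fin.lastCases with
    | last => simpa using hm
    | cast i => simpa using hsz i
  have hinit : sz = fun i => (Fin.snoc sz m : Fin (k + 1) → ℕ) i.castSucc := by simp
  generalize (Fin.snoc sz m : Fin (k + 1) → ℕ) = sz' at hsz' hinit ⊢
  subst hinit
  obtain ⟨f, hf⟩ := hG
  refine ⟨(exists_isHamCycle_succ sz' hsz' heven hf).imp fun _ h => h.1, ?_⟩
  obtain ⟨f, hf, hmrl⟩ := Nat.sSup_mem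
    (s := {n | ∃ f, IsHamCycle (k := k) (sz := fun i => sz' i.castSucc) f ∧ n = runLength f})
    ⟨_, f, hf, rfl⟩ (bddAbove_runLength hsz)
  obtain ⟨F, hF, hwin⟩ := exists_isHamCycle_succ sz' hsz' heven hf
  have hr := runLength_mem hsz hf
  calc mrl k (fun i => sz' i.castSucc) = runLength f := hmrl
    _ ≤ runLength F := le_csSup (bddAbove_windowOk hsz' hF) ⟨hr.1, hwin _ hr.2⟩
    _ ≤ mrl (k + 1) sz' := le_csSup (bddAbove_runLength hsz') ⟨F, hF, rfl⟩
end
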